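/- There exists an absolute constant C > 0 such that the following holds. Let u : ℝ³ → ℝ³ be an axisymmetric, divergence-free Schwartz vector field (u(Rx) = R·u(x) for every rotation R ∈ SO(3) fixing the x₃-axis, and div u = 0). Let ω := curl u, and on {r > 0} set u_r := u·e_r, ω_θ := ω·e_θ, Γ := ω_θ/r, and ∂_r g := (x₁∂₁g + x₂∂₂g)/r. Then ‖∇∂_r(u_r/r)‖_{L²_{3-uloc}({r>0})} + ‖∇∂₃(u_r/r)‖_{L²_{3-uloc}({r>0})} ≤ C·( ‖Γ‖_{L²_{3-uloc}({r>0})} + ‖∇Γ‖_{L²_{3-uloc}({r>0})} ). -/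

import Mathlib

noncomputable section
open Real MeasureTheory Filter Metric Set
open scoped ENNReal NNReal Topology FourierTransform

/-- Three-dimensional Euclidean space. -/
abbrev E3 : Type := EuclideanSpace ℝ (Fin 3)

/-- The `i`-th partial derivative of a scalar function on `ℝ³`. -/
def pd (f : E3 → ℝ) (i : Fin 3) (x : E3) : ℝ :=
  fderiv ℝ f x (EuclideanSpace.single i 1)

/-- The Laplacian of a scalar function on `ℝ³`. -/
def lap (f : E3 → ℝ) (x : E3) : ℝ :=
  ∑ i : Fin 3, pd (fun y => pd f i y) i x

/-- `(u, pr)` is a classical solution of the Navier–Stokes equations on the time interval `I`. -/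
def IsNSSol (u : ℝ → E3 → E3) (pr : ℝ → E3 → ℝ) (I : Set ℝ) : Prop :=
  (ContDiff ℝ (⊤:ℕ∞) fun q : ℝ × E3 => u q.1 q.2) ∧
  (ContDiff ℝ (⊤:ℕ∞) fun q : ℝ × E3 => pr q.1 q.2) ∧
  (∀ t ∈ I, ∀ x : E3, ∀ i : Fin 3,
    deriv (fun s => u s x i) t - lap (fun y => u t y i) x
      + (∑ j : Fin 3, u t x j * pd (fun y => u t y i) j x) + pd (pr t) i x = 0) ∧
  (∀ t ∈ I, ∀ x : E3, (∑ i : Fin 3, pd (fun y => u t y i) i x) = 0)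

/-- Rotation by angle `θ` about the `x₃`-axis. -/
def rotZ (θ : ℝ) (x : E3) : E3 :=
  (WithLp.equiv 2 (Fin 3 → ℝ)).symm
    ![x 0 * Real.cos θ - x 1 * Real.sin θ, x 0 * Real.sin θ + x 1 * Real.cos θ, x 2]

/-- A time-dependent vector field is axisymmetric. -/
def AxiSym (u : ℝ → E3 → E3) : Prop := ∀ θ t x, u t (rotZ θ x) = rotZ θ (u t x)

/-- The weak `L^q` (quasi)norm `sup_{λ>0} λ · vol{|f| ≥ λ}^{1/q}`. -/
def wnorm' {F : Type*} [NormedAddCommGroup F] (f : E3 → F) (q : ℝ) : ℝ≥0∞ :=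
  ⨆ (l : ℝ) (_ : 0 < l), ENNReal.ofReal l * (volume {x : E3 | l ≤ ‖f x‖}) ^ (1 / q)

/-- The weak `L^3` norm. -/
def wnorm3 (f : E3 → E3) : ℝ≥0∞ := wnorm' f 3

/-- Distance to the `x₃`-axis. -/
def rr (x : E3) : ℝ := Real.sqrt (x 0 ^ 2 + x 1 ^ 2)

/-- The `x₃`-uniformly-local `L^p` norm over a region `Ω`. -/
def uloc3On {F : Type*} [NormedAddCommGroup F] (g : E3 → F) (p : ℝ≥0∞) (Ω : Set E3) : ℝ≥0∞ :=
  ⨆ z : ℝ, eLpNorm g p (volume.restrict (Ω ∩ {x : E3 | x 2 ∈ Set.Icc (z - 1) (z + 1)}))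

/-- The `x₃`-uniformly-local `L^p` norm. -/
def uloc3 {F : Type*} [NormedAddCommGroup F] (g : E3 → F) (p : ℝ≥0∞) : ℝ≥0∞ :=
  uloc3On g p Set.univ


/-- First component of the curl of a vector field. -/
def omega1 (v : E3 → E3) (x : E3) : ℝ :=
  pd (fun y => v y 2) 1 x - pd (fun y => v y 1) 2 x

/-- Second component of the curl of a vector field. -/
def omega2 (v : E3 → E3) (x : E3) : ℝ :=
  pd (fun y => v y 0) 2 x - pd (fun y => v y 2) 0 x


/-- `u_r / r` for a vector field `v`. -/
def urr (v : E3 → E3) (x : E3) : ℝ := ((x 0 * v x 0 + x 1 * v x 1) / rr x) / rr x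

/-- The radial derivative `∂_r g = (x₁ ∂₁ g + x₂ ∂₂ g)/r`. -/
def dr (g : E3 → ℝ) (x : E3) : ℝ := (x 0 * pd g 0 x + x 1 * pd g 1 x) / rr x

/-- `Γ = ω_θ / r` for a vector field `v`. -/
def GammaOf (v : E3 → E3) (x : E3) : ℝ :=
  ((-(x 1) * omega1 v x + x 0 * omega2 v x) / rr x) / rr x

/-- Schwartz functions on the `(r, z)`-plane. -/
abbrev PlaneSchwartz : Type := SchwartzMap (ℝ × ℝ) ℝ

namespace PlaneSchwartz

open LineDeriv SchwartzMap

/-- The derivative in the first variable. -/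
def dρ (f : PlaneSchwartz) : PlaneSchwartz := ∂_{((1 : ℝ), (0 : ℝ))} f

/-- The derivative in the second variable. -/
def dζ (f : PlaneSchwartz) : PlaneSchwartz := ∂_{((0 : ℝ), (1 : ℝ))} f

/-- The pointwise product of two Schwartz functions. -/
def mulS (f g : PlaneSchwartz) : PlaneSchwartz := smulLeftCLM ℝ (⇑f) g

/-- Multiplication by the first variable. -/
def mulρ (f : PlaneSchwartz) : PlaneSchwartz := smulLeftCLM ℝ (fun p : ℝ × ℝ => p.1) f

lemma fst_hasTemperateGrowth : (fun p : ℝ × ℝ => p.1).HasTemperateGrowth :=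
  (ContinuousLinearMap.fst ℝ ℝ ℝ).hasTemperateGrowth

lemma snd_hasTemperateGrowth : (fun p : ℝ × ℝ => p.2).HasTemperateGrowth :=
  (ContinuousLinearMap.snd ℝ ℝ ℝ).hasTemperateGrowth

@[simp] lemma mulS_apply (f g : PlaneSchwartz) (p : ℝ × ℝ) : mulS f g p = f p * g p := by
  simp [mulS, smulLeftCLM_apply_apply f.hasTemperateGrowth]

@[simp] lemma mulρ_apply (f : PlaneSchwartz) (p : ℝ × ℝ) : mulρ f p = p.1 * f p := by
  simp [mulρ, smulLeftCLM_apply_apply fst_hasTemperateGrowth]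

lemma dρ_apply (f : PlaneSchwartz) (p : ℝ × ℝ) : dρ f p = fderiv ℝ f p (1, 0) :=
  lineDerivOp_apply_eq_fderiv _ _ _

lemma dζ_apply (f : PlaneSchwartz) (p : ℝ × ℝ) : dζ f p = fderiv ℝ f p (0, 1) :=
  lineDerivOp_apply_eq_fderiv _ _ _

lemma fderiv_eq (f : PlaneSchwartz) (p : ℝ × ℝ) :
    fderiv ℝ f p = dρ f p • ContinuousLinearMap.fst ℝ ℝ ℝ
      + dζ f p • ContinuousLinearMap.snd ℝ ℝ ℝ := by
  ext <;> simp [dρ_apply, dζ_apply]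

lemma hasFDerivAt' (f : PlaneSchwartz) (p : ℝ × ℝ) :
    HasFDerivAt f (dρ f p • ContinuousLinearMap.fst ℝ ℝ ℝ
      + dζ f p • ContinuousLinearMap.snd ℝ ℝ ℝ) p :=
  fderiv_eq f p ▸ f.hasFDerivAt p

lemma hasDerivAt_comp (f : PlaneSchwartz) {a b : ℝ → ℝ} {a' b' t : ℝ}
    (ha : HasDerivAt a a' t) (hb : HasDerivAt b b' t) :
    HasDerivAt (fun s => f (a s, b s)) (dρ f (a t, b t) * a' + dζ f (a t, b t) * b') t := by
  simpa [Function.comp_def] using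
    (hasFDerivAt' f (a t, b t)).comp_hasDerivAt t (ha.prodMk hb)

lemma hasDerivAt_fst (f : PlaneSchwartz) (r z : ℝ) :
    HasDerivAt (fun s => f (s, z)) (dρ f (r, z)) r := by
  simpa using hasDerivAt_comp f (hasDerivAt_id r) (hasDerivAt_const r z)

lemma hasDerivAt_snd (f : PlaneSchwartz) (r z : ℝ) :
    HasDerivAt (fun s => f (r, s)) (dζ f (r, z)) z := by
  simpa using hasDerivAt_comp f (hasDerivAt_const z r) (hasDerivAt_id z)

lemma dρ_eq_of_hasDerivAt {f : PlaneSchwartz} {p : ℝ × ℝ} {d : ℝ}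
    (h : HasDerivAt (fun s => f (s, p.2)) d p.1) : dρ f p = d :=
  (hasDerivAt_fst f p.1 p.2).unique h

lemma dζ_eq_of_hasDerivAt {f : PlaneSchwartz} {p : ℝ × ℝ} {d : ℝ}
    (h : HasDerivAt (fun s => f (p.1, s)) d p.2) : dζ f p = d :=
  (hasDerivAt_snd f p.1 p.2).unique h

lemma dρ_mulS (f g : PlaneSchwartz) (p : ℝ × ℝ) :
    dρ (mulS f g) p = dρ f p * g p + f p * dρ g p :=
  dρ_eq_of_hasDerivAt (by
    simpa using (hasDerivAt_fst f p.1 p.2).fun_mul (hasDerivAt_fst g p.1 p.2))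

lemma dζ_mulS (f g : PlaneSchwartz) (p : ℝ × ℝ) :
    dζ (mulS f g) p = dζ f p * g p + f p * dζ g p :=
  dζ_eq_of_hasDerivAt (by
    simpa using (hasDerivAt_snd f p.1 p.2).fun_mul (hasDerivAt_snd g p.1 p.2))

lemma dρ_mulρ (f : PlaneSchwartz) (p : ℝ × ℝ) : dρ (mulρ f) p = f p + p.1 * dρ f p :=
  dρ_eq_of_hasDerivAt (by
    simpa using (hasDerivAt_id p.1).fun_mul (hasDerivAt_fst f p.1 p.2))

lemma dζ_mulρ (f : PlaneSchwartz) (p : ℝ × ℝ) : dζ (mulρ f) p = p.1 * dζ f p :=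
  dζ_eq_of_hasDerivAt (by
    simpa using (hasDerivAt_snd f p.1 p.2).const_mul p.1)

lemma dρ_dζ (f : PlaneSchwartz) : dρ (dζ f) = dζ (dρ f) := by
  ext p
  have h : IsSymmSndFDerivAt ℝ f p :=
    (f.contDiffAt 2).isSymmSndFDerivAt (by simp)
  have key : ∀ v w : ℝ × ℝ, fderiv ℝ (fun q => fderiv ℝ f q v) p w
      = fderiv ℝ (fderiv ℝ f) p w v := by
    intro v w
    have hd : DifferentiableAt ℝ (fderiv ℝ f) p := (fderivCLM ℝ _ _ f).differentiableAt
    rw [fderiv_clm_apply hd (differentiableAt_const v)]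
    simp
  have h1 : (⇑(dζ f) : ℝ × ℝ → ℝ) = fun q => fderiv ℝ f q (0, 1) := funext (dζ_apply f)
  have h2 : (⇑(dρ f) : ℝ × ℝ → ℝ) = fun q => fderiv ℝ f q (1, 0) := funext (dρ_apply f)
  rw [dρ_apply, dζ_apply, h1, h2, key, key]
  exact h _ _

@[simp] lemma dρ_add (f g : PlaneSchwartz) : dρ (f + g) = dρ f + dρ g := lineDerivOp_add _ _ _
@[simp] lemma dζ_add (f g : PlaneSchwartz) : dζ (f + g) = dζ f + dζ g := lineDerivOp_add _ _ _
@[simp] lemma dρ_sub (f g : PlaneSchwartz) : dρ (f - g) = dρ f - dρ g := by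
  simp [sub_eq_add_neg, dρ, lineDerivOp_add, lineDerivOp_neg]
@[simp] lemma dζ_sub (f g : PlaneSchwartz) : dζ (f - g) = dζ f - dζ g := by
  simp [sub_eq_add_neg, dζ, lineDerivOp_add, lineDerivOp_neg]
@[simp] lemma dρ_smul (c : ℝ) (f : PlaneSchwartz) : dρ (c • f) = c • dρ f :=
  lineDerivOp_smul _ _ _
@[simp] lemma dζ_smul (c : ℝ) (f : PlaneSchwartz) : dζ (c • f) = c • dζ f :=
  lineDerivOp_smul _ _ _

lemma eq_of_mul_fst_eq {f g : PlaneSchwartz} (h : ∀ p : ℝ × ℝ, p.1 ≠ 0 → f p = g p) :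
    f = g := by
  have hd : Dense {p : ℝ × ℝ | p.1 ≠ 0} := by
    have : {p : ℝ × ℝ | p.1 ≠ 0} = ({0}ᶜ : Set ℝ) ×ˢ (univ : Set ℝ) := by
      ext; simp
    rw [this]
    exact (dense_compl_singleton 0).prod dense_univ
  exact DFunLike.coe_injective (Continuous.ext_on hd f.continuous g.continuous fun p hp => h p hp)

/-- The slice of a Schwartz function at a fixed first coordinate. -/
def sliceSnd (f : PlaneSchwartz) (r : ℝ) : SchwartzMap ℝ ℝ :=
  compCLMOfAntilipschitz ℝ (K := 1) (g := fun z : ℝ => (r, z))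
    (by
      have h1 : (fun _ : ℝ => ((r, 0) : ℝ × ℝ)).HasTemperateGrowth := .const _
      have h2 := (ContinuousLinearMap.inr ℝ ℝ ℝ).hasTemperateGrowth
      convert h1.add h2 using 1
      ext z <;> simp)
    (by
      refine AntilipschitzWith.of_le_mul_dist fun x y => ?_
      simp [Prod.dist_eq]) f

/-- The slice of a Schwartz function at a fixed second coordinate. -/
def sliceFst (f : PlaneSchwartz) (z : ℝ) : SchwartzMap ℝ ℝ :=
  compCLMOfAntilipschitz ℝ (K := 1) (g := fun r : ℝ => (r, z))
    (by
      have h1 : (fun _ : ℝ => ((0, z) : ℝ × ℝ)).HasTemperateGrowth := .const _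
      have h2 := (ContinuousLinearMap.inl ℝ ℝ ℝ).hasTemperateGrowth
      convert h1.add h2 using 1
      ext z <;> simp)
    (by
      refine AntilipschitzWith.of_le_mul_dist fun x y => ?_
      simp [Prod.dist_eq]) f

@[simp] lemma sliceSnd_apply (f : PlaneSchwartz) (r z : ℝ) : sliceSnd f r z = f (r, z) := rfl
@[simp] lemma sliceFst_apply (f : PlaneSchwartz) (r z : ℝ) : sliceFst f z r = f (r, z) := rfl

/-- The open half-plane `{r > 0}`. -/
def halfPlane : Set (ℝ × ℝ) := {p | 0 < p.1}

lemma measurableSet_halfPlane : MeasurableSet halfPlane :=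
  measurableSet_lt measurable_const measurable_fst

lemma halfPlane_eq_prod : halfPlane = Ioi (0 : ℝ) ×ˢ (univ : Set ℝ) := by
  ext; simp [halfPlane]

lemma restrict_halfPlane :
    (volume : Measure (ℝ × ℝ)).restrict halfPlane
      = ((volume : Measure ℝ).restrict (Ioi 0)).prod (volume : Measure ℝ) := by
  rw [halfPlane_eq_prod, Measure.volume_eq_prod, ← Measure.prod_restrict, Measure.restrict_univ]

lemma setIntegral_dζ (f : PlaneSchwartz) : ∫ p in halfPlane, dζ f p = 0 := by
  have hi : Integrable (dζ f) ((volume : Measure (ℝ × ℝ)).restrict halfPlane) :=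
    (dζ f).integrable.restrict
  rw [restrict_halfPlane] at hi ⊢
  rw [integral_prod _ hi]
  have : ∀ r : ℝ, ∫ z, dζ f (r, z) = 0 := fun r =>
    integral_eq_zero_of_hasDerivAt_of_integrable (fun z => hasDerivAt_snd f r z)
      (sliceSnd (dζ f) r).integrable (sliceSnd f r).integrable
  simp [this]

lemma setIntegral_dρ (f : PlaneSchwartz) :
    ∫ p in halfPlane, dρ f p = -∫ z, f (0, z) := by
  have hi : Integrable (dρ f) ((volume : Measure (ℝ × ℝ)).restrict halfPlane) :=
    (dρ f).integrable.restrict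
  rw [restrict_halfPlane] at hi ⊢
  rw [integral_prod_symm _ hi, ← integral_neg]
  congr 1
  ext z
  have ht : Tendsto (fun r => f (r, z)) atTop (𝓝 0) :=
    (tendsto_cocompact (sliceFst f z)).mono_left atTop_le_cocompact
  have := integral_Ioi_of_hasDerivAt_of_tendsto' (a := 0)
    (fun r _ => hasDerivAt_fst f r z) (sliceFst (dρ f) z).integrable.integrableOn ht
  simpa using this

end PlaneSchwartz

namespace PlaneSchwartz

open LineDeriv SchwartzMap

/-- A family of rapidly decaying functions stable under partial differentiation consists of
Schwartz functions. -/
lemma exists_eq_of_stable {S : Set (ℝ × ℝ → ℝ)}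
    (hder : ∀ f ∈ S, ∃ a ∈ S, ∃ b ∈ S, ∀ p, HasFDerivAt f
      (a p • ContinuousLinearMap.fst ℝ ℝ ℝ + b p • ContinuousLinearMap.snd ℝ ℝ ℝ) p)
    (hdec : ∀ f ∈ S, ∀ k : ℕ, ∃ C : ℝ, ∀ p, ‖p‖ ^ k * ‖f p‖ ≤ C)
    {f : ℝ × ℝ → ℝ} (hf : f ∈ S) : ∃ g : PlaneSchwartz, ∀ p, g p = f p := by
  have hsm : ∀ n : ℕ, ∀ f ∈ S, ContDiff ℝ n f := by
    intro n
    induction n with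
    | zero =>
      intro f hf
      obtain ⟨a, _, b, _, h⟩ := hder f hf
      exact contDiff_zero.2 (continuous_iff_continuousAt.2 fun p => (h p).continuousAt)
    | succ n ih =>
      intro f hf
      obtain ⟨a, ha, b, hb, h⟩ := hder f hf
      push_cast
      refine (contDiff_succ_iff_fderiv (n := n)).2
        ⟨fun p => (h p).differentiableAt, by simp, ?_⟩
      have : fderiv ℝ f = fun p => a p • ContinuousLinearMap.fst ℝ ℝ ℝ
          + b p • ContinuousLinearMap.snd ℝ ℝ ℝ := funext fun p => (h p).fderiv
      rw [this]
      exact ((ih a ha).smul contDiff_const).add ((ih b hb).smul contDiff_const)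
  have hd : ∀ n : ℕ, ∀ f ∈ S, ∀ k : ℕ, ∃ C : ℝ, ∀ p,
      ‖p‖ ^ k * ‖iteratedFDeriv ℝ n f p‖ ≤ C := by
    intro n
    induction n with
    | zero => simpa using hdec
    | succ n ih =>
      intro f hf k
      obtain ⟨a, ha, b, hb, h⟩ := hder f hf
      obtain ⟨A, hA⟩ := ih a ha k
      obtain ⟨B, hB⟩ := ih b hb k
      set L₁ : ℝ →L[ℝ] (ℝ × ℝ →L[ℝ] ℝ) :=
        (ContinuousLinearMap.id ℝ ℝ).smulRight (ContinuousLinearMap.fst ℝ ℝ ℝ)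
      set L₂ : ℝ →L[ℝ] (ℝ × ℝ →L[ℝ] ℝ) :=
        (ContinuousLinearMap.id ℝ ℝ).smulRight (ContinuousLinearMap.snd ℝ ℝ ℝ)
      have hfd : fderiv ℝ f = (L₁ ∘ a) + (L₂ ∘ b) := funext fun p => (h p).fderiv
      refine ⟨‖L₁‖ * A + ‖L₂‖ * B, fun p => ?_⟩
      rw [← norm_iteratedFDeriv_fderiv, hfd]
      have hca : ContDiffAt ℝ n a p := (hsm n a ha).contDiffAt
      have hcb : ContDiffAt ℝ n b p := (hsm n b hb).contDiffAt
      rw [iteratedFDeriv_add_apply (L₁.contDiff.contDiffAt.comp p hca)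
        (L₂.contDiff.contDiffAt.comp p hcb)]
      have h1 := L₁.norm_iteratedFDeriv_comp_left hca le_rfl
      have h2 := L₂.norm_iteratedFDeriv_comp_left hcb le_rfl
      calc _ ≤ ‖p‖ ^ k * (‖L₁‖ * ‖iteratedFDeriv ℝ n a p‖
              + ‖L₂‖ * ‖iteratedFDeriv ℝ n b p‖) := by
            gcongr
            exact (norm_add_le _ _).trans (add_le_add h1 h2)
        _ = ‖L₁‖ * (‖p‖ ^ k * ‖iteratedFDeriv ℝ n a p‖)
              + ‖L₂‖ * (‖p‖ ^ k * ‖iteratedFDeriv ℝ n b p‖) := by ring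
        _ ≤ _ := by gcongr; exacts [hA p, hB p]
  exact ⟨⟨f, contDiff_infty.2 fun n => hsm n f hf, fun k n => hd n f hf k⟩, fun p => rfl⟩

lemma iterate_dρ_dζ (m : ℕ) (Q : PlaneSchwartz) : dρ^[m] (dζ Q) = dζ (dρ^[m] Q) := by
  induction m generalizing Q with
  | zero => rfl
  | succ m ih => rw [Function.iterate_succ_apply, dρ_dζ, ih, ← Function.iterate_succ_apply]

/-- The averages of radial derivatives that represent the derivatives of `Q / r`. -/
def radialMean (m : ℕ) (Q : PlaneSchwartz) (p : ℝ × ℝ) : ℝ :=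
  ∫ s in (0 : ℝ)..1, s ^ m * (dρ^[m + 1] Q) (s * p.1, p.2)

lemma exists_decay (Q : PlaneSchwartz) (k : ℕ) : ∃ C : ℝ, 0 ≤ C ∧ ∀ p, ‖p‖ ^ k * |Q p| ≤ C := by
  obtain ⟨C, hC⟩ := Q.decay k 0
  exact ⟨C, hC.1.le, fun p => by simpa using hC.2 p⟩

lemma continuous_radialMean_integrand (m : ℕ) (Q : PlaneSchwartz) (p : ℝ × ℝ) :
    Continuous fun s : ℝ => s ^ m * (dρ^[m + 1] Q) (s * p.1, p.2) := by
  have := (dρ^[m + 1] Q).continuous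
  fun_prop

lemma hasFDerivAt_radialMean (m : ℕ) (Q : PlaneSchwartz) (p : ℝ × ℝ) :
    HasFDerivAt (radialMean m Q) (radialMean (m + 1) Q p • ContinuousLinearMap.fst ℝ ℝ ℝ
      + radialMean m (dζ Q) p • ContinuousLinearMap.snd ℝ ℝ ℝ) p := by
  set R := dρ^[m + 1] Q with hR
  have hR1 : dρ^[m + 1 + 1] Q = dρ R := by rw [Function.iterate_succ_apply', hR]
  have hR2 : dρ^[m + 1] (dζ Q) = dζ R := iterate_dρ_dζ _ _
  let F' : ℝ × ℝ → ℝ → (ℝ × ℝ →L[ℝ] ℝ) := fun q s =>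
    (s ^ (m + 1) * dρ R (s * q.1, q.2)) • ContinuousLinearMap.fst ℝ ℝ ℝ
      + (s ^ m * dζ R (s * q.1, q.2)) • ContinuousLinearMap.snd ℝ ℝ ℝ
  obtain ⟨A, hA0, hA⟩ := exists_decay (dρ R) 0
  obtain ⟨B, hB0, hB⟩ := exists_decay (dζ R) 0
  have hFc : ∀ q : ℝ × ℝ, Continuous fun s : ℝ => s ^ m * R (s * q.1, q.2) := fun q =>
    continuous_radialMean_integrand m Q q
  have hF1c : ∀ q : ℝ × ℝ, Continuous fun s : ℝ => s ^ (m + 1) * dρ R (s * q.1, q.2) := by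
    intro q
    have := (dρ R).continuous
    fun_prop
  have hF2c : ∀ q : ℝ × ℝ, Continuous fun s : ℝ => s ^ m * dζ R (s * q.1, q.2) := by
    intro q
    have := (dζ R).continuous
    fun_prop
  have hF'c : ∀ q, Continuous (F' q) := fun q =>
    ((hF1c q).smul continuous_const).add ((hF2c q).smul continuous_const)
  have main := intervalIntegral.hasFDerivAt_integral_of_dominated_of_fderiv_le (𝕜 := ℝ)
    (μ := volume) (a := 0) (b := 1) (s := univ) (x₀ := p)
    (F := fun (q : ℝ × ℝ) s => s ^ m * R (s * q.1, q.2)) (F' := F')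
    (bound := fun _ => A * ‖ContinuousLinearMap.fst ℝ ℝ ℝ‖ + B * ‖ContinuousLinearMap.snd ℝ ℝ ℝ‖)
    univ_mem (Eventually.of_forall fun q => (hFc q).aestronglyMeasurable)
    ((hFc p).intervalIntegrable _ _) (hF'c p).aestronglyMeasurable
    (ae_of_all _ fun s hs q _ => ?_) intervalIntegrable_const (ae_of_all _ fun s hs q _ => ?_)
  · have e1 : ∀ s, F' p s = (s ^ (m + 1) * dρ R (s * p.1, p.2)) • ContinuousLinearMap.fst ℝ ℝ ℝ
      + (s ^ m * dζ R (s * p.1, p.2)) • ContinuousLinearMap.snd ℝ ℝ ℝ := fun _ => rfl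
    have i1 : IntervalIntegrable (fun s : ℝ => (s ^ (m + 1) * dρ R (s * p.1, p.2)) •
        ContinuousLinearMap.fst ℝ ℝ ℝ) volume 0 1 :=
      ((hF1c p).smul continuous_const).intervalIntegrable _ _
    have i2 : IntervalIntegrable (fun s : ℝ => (s ^ m * dζ R (s * p.1, p.2)) •
        ContinuousLinearMap.snd ℝ ℝ ℝ) volume 0 1 :=
      ((hF2c p).smul continuous_const).intervalIntegrable _ _
    simp only [e1] at main
    rw [intervalIntegral.integral_add i1 i2,
      intervalIntegral.integral_smul_const, intervalIntegral.integral_smul_const] at main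
    have e2 : radialMean m Q = fun q => ∫ s in (0 : ℝ)..1, s ^ m * R (s * q.1, q.2) := rfl
    rw [e2]
    simp only [radialMean, hR1, hR2]
    exact main
  · rw [uIoc_of_le zero_le_one] at hs
    have hs1 : ∀ n : ℕ, |s ^ n| ≤ 1 := fun n => by
      rw [abs_of_nonneg (pow_nonneg hs.1.le n)]
      exact pow_le_one₀ hs.1.le hs.2
    refine (norm_add_le _ _).trans (add_le_add ?_ ?_)
    · rw [norm_smul, norm_mul]
      gcongr
      have := hA (s * q.1, q.2)
      simp only [pow_zero, one_mul] at this
      calc _ ≤ 1 * A := mul_le_mul (hs1 _) this (abs_nonneg _) zero_le_one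
        _ = A := one_mul A
    · rw [norm_smul, norm_mul]
      gcongr
      have := hB (s * q.1, q.2)
      simp only [pow_zero, one_mul] at this
      calc _ ≤ 1 * B := mul_le_mul (hs1 _) this (abs_nonneg _) zero_le_one
        _ = B := one_mul B
  · have h1 : HasFDerivAt (fun q : ℝ × ℝ => (s * q.1, q.2))
        ((s • ContinuousLinearMap.fst ℝ ℝ ℝ).prod (ContinuousLinearMap.snd ℝ ℝ ℝ)) q :=
      ((hasFDerivAt_fst).const_mul s).prodMk hasFDerivAt_snd
    have h2 := ((hasFDerivAt' R (s * q.1, q.2)).comp q h1).const_mul (s ^ m)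
    refine h2.congr_fderiv ?_
    ext <;> simp [F']
    ring

lemma fst_mul_radialMean_zero {Q : PlaneSchwartz} (hQ : ∀ z, Q (0, z) = 0) (p : ℝ × ℝ) :
    p.1 * radialMean 0 Q p = Q p := by
  have h : ∀ s ∈ uIcc (0 : ℝ) 1, HasDerivAt (fun s => Q (s * p.1, p.2))
      (p.1 * (s ^ 0 * dρ Q (s * p.1, p.2))) s := fun s _ => by
    have := hasDerivAt_comp Q ((hasDerivAt_id s).mul_const p.1) (hasDerivAt_const s p.2)
    exact this.congr_deriv (by simp [mul_comm])
  have := intervalIntegral.integral_eq_sub_of_hasDerivAt h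
    ((continuous_const.mul (continuous_radialMean_integrand 0 Q p)).intervalIntegrable _ _)
  rw [intervalIntegral.integral_const_mul] at this
  simpa [radialMean, hQ] using this

lemma fst_mul_radialMean_succ (m : ℕ) (Q : PlaneSchwartz) (p : ℝ × ℝ) :
    p.1 * radialMean (m + 1) Q p = (dρ^[m + 1] Q) p - (m + 1) * radialMean m Q p := by
  set R := dρ^[m + 1] Q with hR
  have hR1 : dρ^[m + 1 + 1] Q = dρ R := by rw [Function.iterate_succ_apply', hR]
  have hc1 := continuous_radialMean_integrand m Q p
  have hc2 := continuous_radialMean_integrand (m + 1) Q p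
  rw [hR1] at hc2
  have h : ∀ s ∈ uIcc (0 : ℝ) 1, HasDerivAt (fun s => s ^ (m + 1) * R (s * p.1, p.2))
      (p.1 * (s ^ (m + 1) * dρ R (s * p.1, p.2)) + (m + 1) * (s ^ m * R (s * p.1, p.2))) s :=
    fun s _ => by
      have := hasDerivAt_comp R ((hasDerivAt_id s).mul_const p.1) (hasDerivAt_const s p.2)
      exact ((hasDerivAt_pow (m + 1) s).fun_mul this).congr_deriv (by simp; ring)
  have := intervalIntegral.integral_eq_sub_of_hasDerivAt h
    (((continuous_const.mul hc2).add (continuous_const.mul hc1)).intervalIntegrable _ _)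
  rw [intervalIntegral.integral_add ((hc2.intervalIntegrable _ _).const_mul _)
    ((hc1.intervalIntegrable _ _).const_mul _), intervalIntegral.integral_const_mul,
    intervalIntegral.integral_const_mul] at this
  simp only [radialMean, hR1, ← hR]
  simp only [one_pow, one_mul, zero_pow (Nat.succ_ne_zero m), zero_mul, sub_zero, ← hR] at this
  linarith

lemma exists_snd_pow_mul_radialMean_le (m : ℕ) (Q : PlaneSchwartz) (k : ℕ) :
    ∃ C : ℝ, ∀ p : ℝ × ℝ, |p.2| ^ k * |radialMean m Q p| ≤ C := by
  obtain ⟨C, hC0, hC⟩ := exists_decay (dρ^[m + 1] Q) k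
  refine ⟨C, fun p => ?_⟩
  have : |p.2| ^ k * |radialMean m Q p|
      = ‖∫ s in (0 : ℝ)..1, |p.2| ^ k * (s ^ m * (dρ^[m + 1] Q) (s * p.1, p.2))‖ := by
    rw [intervalIntegral.integral_const_mul, norm_mul]
    simp [radialMean]
  rw [this]
  refine (intervalIntegral.norm_integral_le_of_norm_le_const (C := C) fun s hs => ?_).trans
    (by simp)
  rw [uIoc_of_le zero_le_one] at hs
  have h1 : |s ^ m| ≤ 1 := by
    rw [abs_of_nonneg (pow_nonneg hs.1.le m)]
    exact pow_le_one₀ hs.1.le hs.2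
  have h2 : |p.2| ≤ ‖(s * p.1, p.2)‖ := by
    rw [Prod.norm_def]; exact le_max_right _ _
  rw [norm_mul, norm_mul, norm_pow, norm_eq_abs, abs_abs, norm_eq_abs, norm_eq_abs]
  calc |p.2| ^ k * (|s ^ m| * |(dρ^[m + 1] Q) (s * p.1, p.2)|)
      ≤ ‖(s * p.1, p.2)‖ ^ k * (1 * |(dρ^[m + 1] Q) (s * p.1, p.2)|) := by gcongr
    _ ≤ C := by rw [one_mul]; exact hC _

lemma exists_fst_pow_mul_radialMean_le (k m : ℕ) {Q : PlaneSchwartz} (hQ : ∀ z, Q (0, z) = 0) :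
    ∃ C : ℝ, ∀ p : ℝ × ℝ, |p.1| ^ k * |radialMean m Q p| ≤ C := by
  induction k generalizing m with
  | zero => simpa using exists_snd_pow_mul_radialMean_le m Q 0
  | succ k ih =>
    have hfst : ∀ p : ℝ × ℝ, |p.1| ≤ ‖p‖ := fun p => norm_fst_le p
    cases m with
    | zero =>
      obtain ⟨C, hC0, hC⟩ := exists_decay Q k
      refine ⟨C, fun p => ?_⟩
      rw [pow_succ, mul_assoc, ← abs_mul, fst_mul_radialMean_zero hQ]
      exact (mul_le_mul_of_nonneg_right (pow_le_pow_left₀ (abs_nonneg _) (hfst p) k)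
        (abs_nonneg _)).trans (hC p)
    | succ m =>
      obtain ⟨C, hC0, hC⟩ := exists_decay (dρ^[m + 1] Q) k
      obtain ⟨D, hD⟩ := ih m
      refine ⟨C + (m + 1) * D, fun p => ?_⟩
      rw [pow_succ, mul_assoc, ← abs_mul, fst_mul_radialMean_succ]
      calc |p.1| ^ k * |(dρ^[m + 1] Q) p - (m + 1) * radialMean m Q p|
          ≤ |p.1| ^ k * (|(dρ^[m + 1] Q) p| + (m + 1) * |radialMean m Q p|) := by
            gcongr
            refine (abs_sub _ _).trans (add_le_add le_rfl ?_)
            rw [abs_mul, abs_of_nonneg (by positivity : (0 : ℝ) ≤ m + 1)]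
        _ = |p.1| ^ k * |(dρ^[m + 1] Q) p| + (m + 1) * (|p.1| ^ k * |radialMean m Q p|) := by ring
        _ ≤ C + (m + 1) * D := by
            gcongr
            · exact (mul_le_mul_of_nonneg_right (pow_le_pow_left₀ (abs_nonneg _) (hfst p) k)
                (abs_nonneg _)).trans (hC p)
            · exact hD p

lemma dζ_axis {Q : PlaneSchwartz} (hQ : ∀ z, Q (0, z) = 0) (z : ℝ) : dζ Q (0, z) = 0 :=
  dζ_eq_of_hasDerivAt (by simpa [hQ] using hasDerivAt_const z (0 : ℝ))

/-- A Schwartz function that vanishes on the axis is divisible by the first variable. -/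
lemma exists_mul_fst_eq {Q : PlaneSchwartz} (hQ : ∀ z, Q (0, z) = 0) :
    ∃ K : PlaneSchwartz, ∀ p, Q p = p.1 * K p := by
  suffices h : ∃ K : PlaneSchwartz, ∀ p, K p = radialMean 0 Q p by
    obtain ⟨K, hK⟩ := h
    exact ⟨K, fun p => by rw [hK, fst_mul_radialMean_zero hQ]⟩
  refine exists_eq_of_stable
    (S := {f | ∃ (m : ℕ) (P : PlaneSchwartz), (∀ z, P (0, z) = 0) ∧ f = radialMean m P})
    ?_ ?_ ⟨0, Q, hQ, rfl⟩
  · rintro f ⟨m, P, hP, rfl⟩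
    exact ⟨_, ⟨m + 1, P, hP, rfl⟩, _, ⟨m, dζ P, dζ_axis hP, rfl⟩, hasFDerivAt_radialMean m P⟩
  · rintro f ⟨m, P, hP, rfl⟩ k
    obtain ⟨A, hA⟩ := exists_fst_pow_mul_radialMean_le k m hP
    obtain ⟨B, hB⟩ := exists_snd_pow_mul_radialMean_le m P k
    refine ⟨max A B, fun p => ?_⟩
    rw [Prod.norm_def, norm_eq_abs, norm_eq_abs, norm_eq_abs]
    rcases max_cases |p.1| |p.2| with h | h
    · rw [h.1]; exact (hA p).trans (le_max_left _ _)
    · rw [h.1]; exact (hB p).trans (le_max_right _ _)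

lemma dρ_axis {K : PlaneSchwartz} (hK : ∀ r z, K (-r, z) = K (r, z)) (z : ℝ) :
    dρ K (0, z) = 0 := by
  have h1 := hasDerivAt_fst K 0 z
  have h2 : HasDerivAt (fun s => K (-s, z)) (-dρ K (0, z)) 0 := by
    simpa using hasDerivAt_comp K (hasDerivAt_neg (0 : ℝ)) (hasDerivAt_const (0 : ℝ) z)
  simp only [hK] at h2
  linarith [h1.unique h2]

/-- An odd Schwartz function is the first variable times an even one. -/
lemma exists_mul_fst_eq_of_odd {P : PlaneSchwartz} (hP : ∀ r z, P (-r, z) = -P (r, z)) :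
    ∃ K B : PlaneSchwartz, (∀ p, P p = p.1 * K p) ∧ (∀ p, dρ K p = p.1 * B p) := by
  obtain ⟨K, hK⟩ := exists_mul_fst_eq (Q := P) fun z => by
    have := hP 0 z
    rw [neg_zero] at this
    linarith
  let K' : PlaneSchwartz := compCLMOfContinuousLinearEquiv ℝ
    ((ContinuousLinearEquiv.neg ℝ (M := ℝ)).prodCongr (ContinuousLinearEquiv.refl ℝ ℝ)) K
  have hK' : ∀ p : ℝ × ℝ, K' p = K (-p.1, p.2) := fun p => rfl
  have he : K' = K := eq_of_mul_fst_eq fun p hp => by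
    have h := hP p.1 p.2
    rw [hK, hK] at h
    rw [hK']
    exact mul_left_cancel₀ hp (by simpa using h)
  obtain ⟨B, hB⟩ := exists_mul_fst_eq (Q := dρ K) (dρ_axis fun r z => by
    rw [← hK' (r, z), he])
  exact ⟨K, B, hK, hB⟩

end PlaneSchwartz

namespace PlaneSchwartz

open LineDeriv SchwartzMap

/-- The integral of `r f²` over the half-plane. -/
def energy (f : PlaneSchwartz) : ℝ := ∫ p in halfPlane, p.1 * f p ^ 2

lemma integrableOn_mul_sq (f : PlaneSchwartz) :
    IntegrableOn (fun p : ℝ × ℝ => p.1 * f p ^ 2) halfPlane := by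
  have := (mulρ (mulS f f)).integrable.restrict (μ := volume) (s := halfPlane)
  refine this.congr (ae_of_all _ fun p => ?_)
  simp [sq]

lemma energy_nonneg (f : PlaneSchwartz) : 0 ≤ energy f :=
  setIntegral_nonneg measurableSet_halfPlane fun _ hp =>
    mul_nonneg (le_of_lt hp) (sq_nonneg _)

lemma integral_slice_sq_nonneg (f : PlaneSchwartz) : 0 ≤ ∫ z, mulS f f (0, z) :=
  integral_nonneg fun z => by simpa using mul_self_nonneg (f (0, z))

/-- The weighted second order energy estimate. -/
lemma energy_second_order_le {K B S : PlaneSchwartz} {ε : ℝ} (hε : 0 ≤ ε)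
    (hB : ∀ p, dρ K p = p.1 * B p)
    (hS : ∀ p, S p = dρ (dρ K) p + 3 * B p + dζ (dζ K) p - ε * K p) :
    energy (dρ (dρ K)) + 9 * energy B + energy (dζ (dζ K)) + 2 * energy (dρ (dζ K))
      ≤ energy S := by
  set A : PlaneSchwartz := (3 : ℝ) • mulS (dρ K) (dρ K) - (2 : ℝ) • mulS (dζ K) (dζ K)
    + (2 : ℝ) • mulρ (mulS (dρ K) (dζ (dζ K)))
    - (2 * ε) • (mulρ (mulS K (dρ K)) + mulS K K) with hA
  set D : PlaneSchwartz := (4 : ℝ) • mulS (dρ K) (dζ K)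
    - (2 : ℝ) • mulρ (mulS (dρ K) (dρ (dζ K))) - (2 * ε) • mulρ (mulS K (dζ K)) with hD
  have hAD : ∀ p ∈ halfPlane, dρ A p + dζ D p ≤ p.1 * S p ^ 2 -
      (p.1 * dρ (dρ K) p ^ 2 + 9 * (p.1 * B p ^ 2) + p.1 * dζ (dζ K) p ^ 2
        + 2 * (p.1 * dρ (dζ K) p ^ 2)) := by
    intro p hp
    have hr : 0 ≤ p.1 := le_of_lt hp
    have e : p.1 * S p ^ 2 -
      (p.1 * dρ (dρ K) p ^ 2 + 9 * (p.1 * B p ^ 2) + p.1 * dζ (dζ K) p ^ 2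
        + 2 * (p.1 * dρ (dζ K) p ^ 2)) - (dρ A p + dζ D p)
        = p.1 * (ε ^ 2 * K p ^ 2 + 2 * ε * (dρ K p ^ 2 + dζ K p ^ 2)) := by
      rw [hA, hD]
      simp only [dρ_add, dρ_sub, dρ_smul, dζ_sub, dζ_smul, add_apply, sub_apply,
        smul_apply, dρ_mulS, dζ_mulS, dρ_mulρ, dζ_mulρ, mulS_apply, smul_eq_mul, hS,
        ← dρ_dζ]
      rw [hB]
      ring
    have : 0 ≤ p.1 * (ε ^ 2 * K p ^ 2 + 2 * ε * (dρ K p ^ 2 + dζ K p ^ 2)) := by positivity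
    linarith
  have j0 := integrableOn_mul_sq (dζ (dζ K))
  have j1 := (integrableOn_mul_sq (dρ (dζ K))).const_mul 2
  have j2 : IntegrableOn (fun p => p.1 * dρ (dρ K) p ^ 2 + 9 * (p.1 * B p ^ 2)) halfPlane :=
    (integrableOn_mul_sq (dρ (dρ K))).add ((integrableOn_mul_sq B).const_mul 9)
  have j3 : IntegrableOn (fun p => p.1 * dρ (dρ K) p ^ 2 + 9 * (p.1 * B p ^ 2)
      + p.1 * dζ (dζ K) p ^ 2) halfPlane := j2.add j0
  have j4 : IntegrableOn (fun p => p.1 * dρ (dρ K) p ^ 2 + 9 * (p.1 * B p ^ 2)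
      + p.1 * dζ (dζ K) p ^ 2 + 2 * (p.1 * dρ (dζ K) p ^ 2)) halfPlane := j3.add j1
  have hmono := setIntegral_mono_on (μ := volume) (s := halfPlane)
    ((dρ A).integrable.restrict.add (dζ D).integrable.restrict)
    ((integrableOn_mul_sq S).sub j4) measurableSet_halfPlane hAD
  have hl : ∫ p in halfPlane, (⇑(dρ A) + ⇑(dζ D)) p = - ∫ z, A (0, z) := by
    rw [integral_add' (dρ A).integrable.restrict (dζ D).integrable.restrict, setIntegral_dρ,
      setIntegral_dζ, add_zero]
  have hA0 : ∫ z, A (0, z) = -(2 * ∫ z, mulS (dζ K) (dζ K) (0, z))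
      - 2 * ε * ∫ z, mulS K K (0, z) := by
    rw [← integral_const_mul, ← integral_const_mul, ← integral_neg, ← integral_sub]
    · congr 1
      ext z
      have := hB (0, z)
      simp only [zero_mul] at this
      simp [hA, this]
    · exact ((sliceSnd (mulS (dζ K) (dζ K)) 0).integrable.const_mul 2).neg
    · exact (sliceSnd (mulS K K) 0).integrable.const_mul _
  rw [hl, hA0] at hmono
  have h1 := integral_slice_sq_nonneg (dζ K)
  have h2 := mul_nonneg hε (integral_slice_sq_nonneg K)
  have hr : ∫ p in halfPlane, (p.1 * S p ^ 2 -
      (p.1 * dρ (dρ K) p ^ 2 + 9 * (p.1 * B p ^ 2) + p.1 * dζ (dζ K) p ^ 2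
        + 2 * (p.1 * dρ (dζ K) p ^ 2))) = energy S - (energy (dρ (dρ K)) + 9 * energy B
          + energy (dζ (dζ K)) + 2 * energy (dρ (dζ K))) := by
    simp only [energy]
    rw [integral_sub (integrableOn_mul_sq S) j4, integral_add j3 j1, integral_add j2 j0,
      integral_add (integrableOn_mul_sq (dρ (dρ K))) ((integrableOn_mul_sq B).const_mul 9),
      integral_const_mul, integral_const_mul]
  have hmono' := hmono.trans_eq hr
  linarith

/-- The weighted first order energy estimate. -/
lemma energy_first_order_le {K B g : PlaneSchwartz} {ε : ℝ} (hε : 0 ≤ ε)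
    (hB : ∀ p, dρ K p = p.1 * B p)
    (hg : ∀ p, dρ (dρ K) p + 3 * B p + dζ (dζ K) p - ε * K p = dζ g p) :
    energy (dρ K) + energy (dζ K) ≤ energy g := by
  set A : PlaneSchwartz := mulρ (mulS K (dρ K)) + mulS K K with hA
  set D : PlaneSchwartz := mulρ (mulS K (dζ K)) - mulρ (mulS K g) with hD
  have hAD : ∀ p ∈ halfPlane, p.1 * dρ K p ^ 2 + p.1 * dζ K p ^ 2 ≤
      (dρ A p + dζ D p) + ((1 / 2) * (p.1 * dζ K p ^ 2) + (1 / 2) * (p.1 * g p ^ 2)) := by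
    intro p hp
    have hr : 0 ≤ p.1 := le_of_lt hp
    have e : (dρ A p + dζ D p) + ((1 / 2) * (p.1 * dζ K p ^ 2) + (1 / 2) * (p.1 * g p ^ 2))
        - (p.1 * dρ K p ^ 2 + p.1 * dζ K p ^ 2)
        = p.1 * (ε * K p ^ 2 + (1 / 2) * (dζ K p - g p) ^ 2) := by
      rw [hA, hD]
      simp only [dρ_add, dζ_sub, add_apply, sub_apply,
        dρ_mulS, dζ_mulS, dρ_mulρ, dζ_mulρ, mulS_apply, ← hg]
      rw [hB]
      ring
    have : 0 ≤ p.1 * (ε * K p ^ 2 + (1 / 2) * (dζ K p - g p) ^ 2) := by positivity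
    linarith
  have i1 : IntegrableOn (fun p => dρ A p + dζ D p) halfPlane :=
    (dρ A).integrable.restrict.add (dζ D).integrable.restrict
  have i2 : IntegrableOn (fun p : ℝ × ℝ => (1 / 2) * (p.1 * dζ K p ^ 2)
      + (1 / 2) * (p.1 * g p ^ 2)) halfPlane :=
    ((integrableOn_mul_sq (dζ K)).const_mul _).add ((integrableOn_mul_sq g).const_mul _)
  have hmono := setIntegral_mono_on (μ := volume) (s := halfPlane)
    ((integrableOn_mul_sq (dρ K)).add (integrableOn_mul_sq (dζ K))) (i1.add i2)
    measurableSet_halfPlane hAD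
  rw [integral_add' (integrableOn_mul_sq (dρ K)) (integrableOn_mul_sq (dζ K)),
    integral_add' i1 i2, integral_add (dρ A).integrable.restrict (dζ D).integrable.restrict,
    setIntegral_dρ, setIntegral_dζ,
    integral_add ((integrableOn_mul_sq (dζ K)).const_mul _) ((integrableOn_mul_sq g).const_mul _),
    integral_const_mul, integral_const_mul] at hmono
  have hA0 : ∫ z, A (0, z) = ∫ z, mulS K K (0, z) := by
    congr 1
    ext z
    simp [hA]
  rw [hA0] at hmono
  have h1 := integral_slice_sq_nonneg K
  have h2 := energy_nonneg (dρ K)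
  simp only [energy] at h2 ⊢
  linarith

end PlaneSchwartz

namespace SpaceSchwartz

open LineDeriv SchwartzMap Laplacian

variable {E : Type*} [NormedAddCommGroup E] [InnerProductSpace ℝ E]

/-- The symbol of the resolvent of the Laplacian, up to normalization. -/
def resolventSymbol (c : ℝ) (ξ : E) : ℝ := (1 + ‖c • ξ‖ ^ 2) ^ (-1 : ℝ)

lemma resolventSymbol_hasTemperateGrowth (c : ℝ) :
    (resolventSymbol c : E → ℝ).HasTemperateGrowth :=
  (Function.hasTemperateGrowth_one_add_norm_sq_rpow E (-1)).comp
    (c • ContinuousLinearMap.id ℝ E).hasTemperateGrowth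

/-- The embedding of real Schwartz functions into complex ones. -/
def complexify : SchwartzMap E ℝ →L[ℝ] SchwartzMap E ℂ := postcompCLM Complex.ofRealCLM

/-- The real part of a Schwartz function. -/
def realPart : SchwartzMap E ℂ →L[ℝ] SchwartzMap E ℝ := postcompCLM Complex.reCLM

lemma lineDeriv_realPart (m : E) (f : SchwartzMap E ℂ) :
    ∂_{m} (realPart f) = realPart (∂_{m} f) := by
  ext x
  rw [lineDerivOp_apply_eq_fderiv]
  have : HasFDerivAt (⇑(realPart f)) (Complex.reCLM ∘L fderiv ℝ f x) x :=
    Complex.reCLM.hasFDerivAt.comp x (f.hasFDerivAt x)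
  rw [this.fderiv]
  simp [realPart, lineDerivOp_apply_eq_fderiv]

variable [FiniteDimensional ℝ E]

lemma laplacian_realPart (f : SchwartzMap E ℂ) : Δ (realPart f) = realPart (Δ f) := by
  rw [laplacian_eq_sum (stdOrthonormalBasis ℝ E), laplacian_eq_sum (stdOrthonormalBasis ℝ E),
    map_sum]
  simp only [lineDeriv_realPart]

variable [MeasurableSpace E] [BorelSpace E]

/-- The resolvent of the Laplacian on complex Schwartz functions, up to normalization. -/
def complexResolvent (c : ℝ) : SchwartzMap E ℂ →L[ℝ] SchwartzMap E ℂ :=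
  fourierMultiplierCLM ℂ (resolventSymbol c : E → ℝ)

lemma laplacian_complexResolvent {c ε : ℝ} (hc : c ^ 2 * ε = (2 * π) ^ 2)
    (f : SchwartzMap E ℂ) :
    Δ (complexResolvent c f) - ε • complexResolvent c f = -ε • f := by
  have h1 : ((‖·‖ ^ 2 : E → ℝ)).HasTemperateGrowth := by fun_prop
  have h2 := resolventSymbol_hasTemperateGrowth (E := E) c
  have h3 : (fun _ : E => (1 : ℝ)).HasTemperateGrowth := .const _
  rw [laplacian_eq_fourierMultiplierCLM, complexResolvent,
    fourierMultiplierCLM_fourierMultiplierCLM_apply h1 h2, ← hc]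
  have h4 : (resolventSymbol c : E → ℝ) = (fun _ => 1) - c ^ 2 • ((‖·‖ ^ 2 : E → ℝ) *
      resolventSymbol c) := by
    ext ξ
    have : (1 + ‖c • ξ‖ ^ 2) ≠ 0 := by positivity
    simp only [resolventSymbol, Pi.sub_apply, Pi.smul_apply, Pi.mul_apply, smul_eq_mul,
      rpow_neg_one]
    field_simp
    rw [norm_smul, mul_pow, norm_eq_abs, sq_abs]
    ring
  have h5 : (c ^ 2 • ((‖·‖ ^ 2 : E → ℝ) * resolventSymbol c)).HasTemperateGrowth :=
    (Function.HasTemperateGrowth.const (c ^ 2)).mul (h1.mul h2)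
  have h6 : fourierMultiplierCLM ℂ (resolventSymbol c : E → ℝ) f
      = f - c ^ 2 • fourierMultiplierCLM ℂ ((‖·‖ ^ 2 : E → ℝ) * resolventSymbol c) f := by
    conv_lhs => rw [h4]
    have e : fourierMultiplierCLM ℂ ((fun _ : E => (1 : ℝ)) - c ^ 2 • ((‖·‖ ^ 2 : E → ℝ) *
        resolventSymbol c)) f = fourierMultiplierCLM ℂ (fun _ : E => (1 : ℝ)) f
          - fourierMultiplierCLM ℂ (c ^ 2 • ((‖·‖ ^ 2 : E → ℝ) * resolventSymbol c)) f := by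
      simp only [fourierMultiplierCLM_apply]
      rw [smulLeftCLM_sub h3 h5]
      exact map_sub (FourierTransform.fourierInvCLM ℝ (SchwartzMap E ℂ)) _ _
    rw [e, fourierMultiplierCLM_const, fourierMultiplierCLM_smul (h1.mul h2)]
    simp
  rw [h6]
  module

lemma complexResolvent_comp (c : ℝ) (A : E ≃ₗᵢ[ℝ] E) (f : SchwartzMap E ℂ) :
    complexResolvent c (compCLMOfContinuousLinearEquiv ℝ A.toContinuousLinearEquiv f)
      = compCLMOfContinuousLinearEquiv ℝ A.toContinuousLinearEquiv (complexResolvent c f) := by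
  have h2 := resolventSymbol_hasTemperateGrowth (E := E) c
  have key : ∀ g : SchwartzMap E ℂ,
      𝓕 (compCLMOfContinuousLinearEquiv ℝ A.toContinuousLinearEquiv g)
        = compCLMOfContinuousLinearEquiv ℝ A.toContinuousLinearEquiv (𝓕 g) := by
    intro g
    ext ξ
    simp only [fourier_coe, compCLMOfContinuousLinearEquiv_apply, Function.comp_apply]
    exact Real.fourier_comp_linearIsometry A g ξ
  have key' : ∀ g : SchwartzMap E ℂ,
      𝓕⁻ (compCLMOfContinuousLinearEquiv ℝ A.toContinuousLinearEquiv g)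
        = compCLMOfContinuousLinearEquiv ℝ A.toContinuousLinearEquiv (𝓕⁻ g) := by
    intro g
    ext ξ
    simp only [fourierInv_coe, compCLMOfContinuousLinearEquiv_apply, Function.comp_apply]
    exact Real.fourierInv_comp_linearIsometry A g ξ
  simp only [complexResolvent, fourierMultiplierCLM_apply, key, ← key']
  congr 1
  ext ξ
  simp [smulLeftCLM_apply_apply h2, resolventSymbol, norm_smul]

/-- The resolvent of the Laplacian on real Schwartz functions. -/
def resolvent (ε : ℝ) : SchwartzMap E ℝ →L[ℝ] SchwartzMap E ℝ :=
  -ε⁻¹ • (realPart ∘L complexResolvent (2 * π / √ε) ∘L complexify)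

lemma laplacian_resolvent {ε : ℝ} (hε : 0 < ε) (f : SchwartzMap E ℝ) :
    Δ (resolvent ε f) - ε • resolvent ε f = f := by
  have hc : (2 * π / √ε) ^ 2 * ε = (2 * π) ^ 2 := by
    rw [div_pow, sq_sqrt hε.le, div_mul_cancel₀ _ hε.ne']
  have h := congrArg realPart (laplacian_complexResolvent hc (complexify f))
  have h0 : realPart (complexify f) = f := by
    ext x
    simp [realPart, complexify]
  rw [map_sub, map_smul, map_smul, ← laplacian_realPart, h0] at h
  have e : resolvent ε f = -ε⁻¹ • realPart (complexResolvent (2 * π / √ε) (complexify f)) := rfl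
  have e' : ∀ (a : ℝ) (g : SchwartzMap E ℝ), Δ (a • g) = a • Δ g := fun a g => by
    simp only [laplacian_eq_sum (stdOrthonormalBasis ℝ E), lineDerivOp_smul, Finset.smul_sum]
  rw [e, e', smul_comm, ← smul_sub, h, smul_smul]
  field_simp
  simp

lemma resolvent_comp (ε : ℝ) (A : E ≃ₗᵢ[ℝ] E) (f : SchwartzMap E ℝ) :
    resolvent ε (compCLMOfContinuousLinearEquiv ℝ A.toContinuousLinearEquiv f)
      = compCLMOfContinuousLinearEquiv ℝ A.toContinuousLinearEquiv (resolvent ε f) := by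
  have h1 : complexify (compCLMOfContinuousLinearEquiv ℝ A.toContinuousLinearEquiv f)
    = compCLMOfContinuousLinearEquiv ℝ A.toContinuousLinearEquiv (complexify f) := rfl
  simp only [resolvent, _root_.smul_apply, ContinuousLinearMap.comp_apply, h1,
    complexResolvent_comp, map_smul]
  rfl

end SpaceSchwartz

namespace SpaceSchwartz

open LineDeriv SchwartzMap Laplacian

lemma rotZ_zero (φ : ℝ) (x : E3) : rotZ φ x 0 = x 0 * cos φ - x 1 * sin φ := rfl

lemma rotZ_one (φ : ℝ) (x : E3) : rotZ φ x 1 = x 0 * sin φ + x 1 * cos φ := rfl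

lemma rotZ_two (φ : ℝ) (x : E3) : rotZ φ x 2 = x 2 := rfl

lemma ext_three {x y : E3} (h0 : x 0 = y 0) (h1 : x 1 = y 1) (h2 : x 2 = y 2) : x = y := by
  ext i
  fin_cases i
  exacts [h0, h1, h2]

lemma rotZ_rotZ_neg (φ : ℝ) (x : E3) : rotZ φ (rotZ (-φ) x) = x := by
  have h := sin_sq_add_cos_sq φ
  apply ext_three <;> simp only [rotZ_zero, rotZ_one, rotZ_two, cos_neg, sin_neg]
  · linear_combination x 0 * h
  · linear_combination x 1 * h

lemma rotZ_neg_rotZ (φ : ℝ) (x : E3) : rotZ (-φ) (rotZ φ x) = x := by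
  simpa using rotZ_rotZ_neg (-φ) x

/-- The rotation about the third axis as a linear isometry. -/
def rotIsometry (φ : ℝ) : E3 ≃ₗᵢ[ℝ] E3 where
  toFun := rotZ φ
  invFun := rotZ (-φ)
  left_inv := rotZ_neg_rotZ φ
  right_inv := rotZ_rotZ_neg φ
  map_add' x y := by
    apply ext_three <;> simp only [rotZ_zero, rotZ_one, rotZ_two, PiLp.add_apply] <;> ring
  map_smul' c x := by
    apply ext_three <;>
      simp only [rotZ_zero, rotZ_one, rotZ_two, PiLp.smul_apply, smul_eq_mul, RingHom.id_apply] <;>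
      ring
  norm_map' x := by
    change ‖rotZ φ x‖ = ‖x‖
    rw [EuclideanSpace.norm_eq, EuclideanSpace.norm_eq]
    congr 1
    simp only [Fin.sum_univ_three, rotZ_zero, rotZ_one, rotZ_two, norm_eq_abs, sq_abs]
    linear_combination (x 0 ^ 2 + x 1 ^ 2) * sin_sq_add_cos_sq φ

/-- Composition of a Schwartz function with a rotation. -/
def rotate (φ : ℝ) : SchwartzMap E3 ℝ →L[ℝ] SchwartzMap E3 ℝ :=
  compCLMOfContinuousLinearEquiv ℝ (rotIsometry φ).toContinuousLinearEquiv

@[simp] lemma rotate_apply (φ : ℝ) (f : SchwartzMap E3 ℝ) (x : E3) :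
    rotate φ f x = f (rotZ φ x) := rfl

/-- The standard basis vectors. -/
def basisVec (i : Fin 3) : E3 := EuclideanSpace.single i 1

/-- The partial derivatives of a Schwartz function. -/
def partialS (i : Fin 3) (f : SchwartzMap E3 ℝ) : SchwartzMap E3 ℝ := ∂_{basisVec i} f

lemma partialS_apply (i : Fin 3) (f : SchwartzMap E3 ℝ) (x : E3) : partialS i f x = pd f i x :=
  lineDerivOp_apply_eq_fderiv _ _ _

lemma fderiv_apply_eq (f : SchwartzMap E3 ℝ) (x v : E3) :
    fderiv ℝ f x v = v 0 * partialS 0 f x + v 1 * partialS 1 f x + v 2 * partialS 2 f x := by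
  have hv : v = v 0 • basisVec 0 + v 1 • basisVec 1 + v 2 • basisVec 2 := by
    apply ext_three <;> simp [basisVec]
  conv_lhs => rw [hv]
  simp only [map_add, map_smul, smul_eq_mul, partialS_apply, pd, basisVec]

lemma pd_rotate (φ : ℝ) (f : SchwartzMap E3 ℝ) (i : Fin 3) (x : E3) :
    partialS i (rotate φ f) x = fderiv ℝ f (rotZ φ x) (rotZ φ (basisVec i)) := by
  rw [partialS_apply, pd]
  have : HasFDerivAt (⇑(rotate φ f))
      (fderiv ℝ f (rotZ φ x) ∘L (rotIsometry φ).toContinuousLinearEquiv.toContinuousLinearMap) x :=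
    (f.hasFDerivAt (rotZ φ x)).comp x
      (rotIsometry φ).toContinuousLinearEquiv.toContinuousLinearMap.hasFDerivAt
  rw [this.fderiv]
  rfl

lemma partialS_two_rotate (φ : ℝ) (f : SchwartzMap E3 ℝ) :
    partialS 2 (rotate φ f) = rotate φ (partialS 2 f) := by
  ext x
  rw [pd_rotate, fderiv_apply_eq]
  simp [rotZ_zero, rotZ_one, rotZ_two, basisVec]

/-- Functions with the angular dependence of a horizontal component of an axisymmetric field. -/
def IsHorizontal (f : SchwartzMap E3 ℝ) : Prop :=
  ∀ φ, rotate φ f + rotate (-φ) f = (2 * cos φ) • f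

lemma IsHorizontal.partialS_two {f : SchwartzMap E3 ℝ} (hf : IsHorizontal f) :
    IsHorizontal (partialS 2 f) := fun φ => by
  rw [← partialS_two_rotate, ← partialS_two_rotate]
  have := congrArg (partialS 2) (hf φ)
  simpa only [partialS, lineDerivOp_add, lineDerivOp_smul] using this

lemma IsHorizontal.resolvent {f : SchwartzMap E3 ℝ} (hf : IsHorizontal f) (ε : ℝ) :
    IsHorizontal (resolvent ε f) := fun φ => by
  have h : ∀ φ, rotate φ (SpaceSchwartz.resolvent ε f) = SpaceSchwartz.resolvent ε (rotate φ f) :=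
    fun φ => (resolvent_comp ε (rotIsometry φ) f).symm
  rw [h, h, ← map_add, hf φ, map_smul]

/-- The embedding of the `(r, z)`-plane into space. -/
def planeEmb : ℝ × ℝ →L[ℝ] E3 :=
  (ContinuousLinearMap.fst ℝ ℝ ℝ).smulRight (basisVec 0)
    + (ContinuousLinearMap.snd ℝ ℝ ℝ).smulRight (basisVec 2)

@[simp] lemma planeEmb_zero (p : ℝ × ℝ) : planeEmb p 0 = p.1 := by simp [planeEmb, basisVec]
@[simp] lemma planeEmb_one (p : ℝ × ℝ) : planeEmb p 1 = 0 := by simp [planeEmb, basisVec]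
@[simp] lemma planeEmb_two (p : ℝ × ℝ) : planeEmb p 2 = p.2 := by simp [planeEmb, basisVec]

/-- The restriction of a Schwartz function to the `(r, z)`-plane. -/
def toPlane (f : SchwartzMap E3 ℝ) : PlaneSchwartz :=
  compCLMOfAntilipschitz ℝ (K := 1) (g := planeEmb) planeEmb.hasTemperateGrowth
    (by
      refine AntilipschitzWith.of_le_mul_dist fun p q => ?_
      rw [dist_eq_norm, dist_eq_norm, ← map_sub, NNReal.coe_one, one_mul, Prod.norm_def]
      exact max_le (by simpa using PiLp.norm_apply_le (planeEmb (p - q)) 0)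
        (by simpa using PiLp.norm_apply_le (planeEmb (p - q)) 2)) f

lemma toPlane_apply (f : SchwartzMap E3 ℝ) (p : ℝ × ℝ) : toPlane f p = f (planeEmb p) := rfl

open PlaneSchwartz

lemma dρ_toPlane (f : SchwartzMap E3 ℝ) : dρ (toPlane f) = toPlane (partialS 0 f) := by
  ext p
  have : HasFDerivAt (⇑(toPlane f)) (fderiv ℝ f (planeEmb p) ∘L planeEmb) p :=
    (f.hasFDerivAt (planeEmb p)).comp p planeEmb.hasFDerivAt
  rw [dρ_apply, this.fderiv, ContinuousLinearMap.comp_apply, fderiv_apply_eq]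
  simp [toPlane_apply]

lemma dζ_toPlane (f : SchwartzMap E3 ℝ) : dζ (toPlane f) = toPlane (partialS 2 f) := by
  ext p
  have : HasFDerivAt (⇑(toPlane f)) (fderiv ℝ f (planeEmb p) ∘L planeEmb) p :=
    (f.hasFDerivAt (planeEmb p)).comp p planeEmb.hasFDerivAt
  rw [dζ_apply, this.fderiv, ContinuousLinearMap.comp_apply, fderiv_apply_eq]
  simp [toPlane_apply]

lemma rotZ_pi_planeEmb (r z : ℝ) : rotZ π (planeEmb (r, z)) = planeEmb (-r, z) := by
  apply ext_three <;> simp [rotZ_zero, rotZ_one, rotZ_two]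

lemma rotZ_neg_pi_planeEmb (r z : ℝ) : rotZ (-π) (planeEmb (r, z)) = planeEmb (-r, z) := by
  apply ext_three <;> simp [rotZ_zero, rotZ_one, rotZ_two]

lemma IsHorizontal.toPlane_neg {f : SchwartzMap E3 ℝ} (hf : IsHorizontal f) (r z : ℝ) :
    toPlane f (-r, z) = -toPlane f (r, z) := by
  have := DFunLike.congr_fun (hf π) (planeEmb (r, z))
  simp only [add_apply, rotate_apply, rotZ_pi_planeEmb, rotZ_neg_pi_planeEmb, cos_pi,
    smul_apply, smul_eq_mul] at this
  simp only [toPlane_apply]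
  linarith

lemma hasDerivAt_rotZ (f : SchwartzMap E3 ℝ) (r z φ : ℝ) :
    HasDerivAt (fun φ => f (rotZ φ (planeEmb (r, z))))
      (-(r * sin φ) * partialS 0 f (rotZ φ (planeEmb (r, z)))
        + (r * cos φ) * partialS 1 f (rotZ φ (planeEmb (r, z)))) φ := by
  have hγ : (fun φ => rotZ φ (planeEmb (r, z))) = fun φ =>
      cos φ • (r • basisVec 0) + sin φ • (r • basisVec 1) + z • basisVec 2 := by
    ext1 φ
    apply ext_three <;> simp [rotZ_zero, rotZ_one, rotZ_two, basisVec, mul_comm]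
  have h1 : HasDerivAt (fun φ => rotZ φ (planeEmb (r, z)))
      ((-sin φ) • (r • basisVec 0) + cos φ • (r • basisVec 1)) φ := by
    rw [hγ]
    exact (((hasDerivAt_cos φ).smul_const _).add ((hasDerivAt_sin φ).smul_const _)).add_const _
  refine ((f.hasFDerivAt _).comp_hasDerivAt φ h1).congr_deriv ?_
  rw [fderiv_apply_eq]
  simp [basisVec]
  ring

lemma IsHorizontal.partialS_one_one {f : SchwartzMap E3 ℝ} (hf : IsHorizontal f) (r z : ℝ) :
    r ^ 2 * toPlane (partialS 1 (partialS 1 f)) (r, z)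
      = r * toPlane (partialS 0 f) (r, z) - toPlane f (r, z) := by
  set x := planeEmb (r, z) with hx
  have h0 : rotZ 0 x = x := by apply ext_three <;> simp [rotZ_zero, rotZ_one, rotZ_two]
  set h' : ℝ → ℝ := fun φ => -(r * sin φ) * partialS 0 f (rotZ φ x)
        + (r * cos φ) * partialS 1 f (rotZ φ x) with hh'
  have e1 : ∀ φ, h' φ - h' (-φ) = -(2 * sin φ) * f x := fun φ => by
    have l := (hasDerivAt_rotZ f r z φ).fun_add
      ((hasDerivAt_rotZ f r z (-φ)).comp φ (hasDerivAt_neg φ))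
    have l' : HasDerivAt (fun φ => 2 * cos φ * f x) (2 * (-sin φ) * f x) φ :=
      ((hasDerivAt_cos φ).const_mul 2).mul_const _
    have e : (fun φ => f (rotZ φ x) + f (rotZ (-φ) x)) = fun φ => 2 * cos φ * f x := by
      ext φ
      simpa using DFunLike.congr_fun (hf φ) x
    have := (e ▸ l : HasDerivAt (fun φ => 2 * cos φ * f x) _ φ).unique l'
    simp only [hh']
    linarith
  have d : HasDerivAt h' (-r * partialS 0 f x + r ^ 2 * partialS 1 (partialS 1 f) x) 0 := by
    have l1 := ((hasDerivAt_sin 0).const_mul r).fun_neg.fun_mul (hasDerivAt_rotZ (partialS 0 f) r z 0)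
    have l2 := ((hasDerivAt_cos 0).const_mul r).fun_mul (hasDerivAt_rotZ (partialS 1 f) r z 0)
    refine (l1.fun_add l2).congr_deriv ?_
    rw [← hx, h0]
    simp
    ring
  have d' : HasDerivAt (fun φ => h' (-φ))
      (-(-r * partialS 0 f x + r ^ 2 * partialS 1 (partialS 1 f) x)) 0 := by
    have d0 : HasDerivAt h' (-r * partialS 0 f x + r ^ 2 * partialS 1 (partialS 1 f) x) (-0) := by
      rwa [neg_zero]
    exact (d0.comp 0 (hasDerivAt_neg 0)).congr_deriv (by ring)
  have d2 := d.fun_sub d'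
  simp only [e1] at d2
  have d3 : HasDerivAt (fun φ => -(2 * sin φ) * f x) (-(2 * cos 0) * f x) 0 :=
    ((hasDerivAt_sin 0).const_mul 2).fun_neg.mul_const _
  have := d2.unique d3
  rw [cos_zero] at this
  simp only [toPlane_apply, ← hx]
  linarith

lemma laplacian_apply_eq (f : SchwartzMap E3 ℝ) (x : E3) :
    (Δ f) x = partialS 0 (partialS 0 f) x + partialS 1 (partialS 1 f) x
      + partialS 2 (partialS 2 f) x := by
  rw [laplacian_eq_sum (EuclideanSpace.basisFun (Fin 3) ℝ), Fin.sum_univ_three]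
  simp [partialS, basisVec]

/-- Solvability of the regularized profile equation. -/
lemma exists_profile_solution {N : SchwartzMap E3 ℝ} (hN : IsHorizontal N) {g : PlaneSchwartz}
    (hg : ∀ p, toPlane N p = p.1 * g p) {ε : ℝ} (hε : 0 < ε) :
    ∃ K B : PlaneSchwartz, (∀ p, dρ K p = p.1 * B p) ∧
      ∀ p, dρ (dρ K) p + 3 * B p + dζ (dζ K) p - ε * K p = dζ g p := by
  set V := resolvent ε (partialS 2 N) with hV
  have hVh : IsHorizontal V := hN.partialS_two.resolvent ε
  have hVe : ∀ x, partialS 0 (partialS 0 V) x + partialS 1 (partialS 1 V) x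
      + partialS 2 (partialS 2 V) x - ε * V x = partialS 2 N x := fun x => by
    have := DFunLike.congr_fun (laplacian_resolvent hε (partialS 2 N)) x
    rw [← hV, sub_apply, smul_apply, laplacian_apply_eq, smul_eq_mul] at this
    exact this
  obtain ⟨K, B, hK, hB⟩ := exists_mul_fst_eq_of_odd hVh.toPlane_neg
  refine ⟨K, B, hB, ?_⟩
  have hP : toPlane V = mulρ K := by ext p; simp [hK]
  have hNg : toPlane N = mulρ g := by ext p; simp [hg]
  have h1 : dρ (toPlane V) = K + mulρ (dρ K) := by ext p; rw [hP, dρ_mulρ]; simp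
  have h2 : dζ (dζ (toPlane V)) = mulρ (dζ (dζ K)) := by
    have : dζ (toPlane V) = mulρ (dζ K) := by ext p; rw [hP, dζ_mulρ]; simp
    ext p
    rw [this, dζ_mulρ, mulρ_apply]
  have key : dρ (dρ K) + (3 : ℝ) • B + dζ (dζ K) - ε • K = dζ g := by
    refine eq_of_mul_fst_eq fun p hp => ?_
    have hA := hVe (planeEmb p)
    have e0 : partialS 0 (partialS 0 V) (planeEmb p) = dρ (dρ (toPlane V)) p := by
      rw [dρ_toPlane, dρ_toPlane]; rfl
    have e2 : partialS 2 (partialS 2 V) (planeEmb p) = dζ (dζ (toPlane V)) p := by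
      rw [dζ_toPlane, dζ_toPlane]; rfl
    have e3 : partialS 2 N (planeEmb p) = dζ (toPlane N) p := by rw [dζ_toPlane]; rfl
    have e4 : V (planeEmb p) = toPlane V p := rfl
    have e1 : p.1 * partialS 1 (partialS 1 V) (planeEmb p) = p.1 * (p.1 * B p) := by
      have := hVh.partialS_one_one p.1 p.2
      rw [← dρ_toPlane, h1, hK] at this
      simp only [add_apply, mulρ_apply, Prod.mk.eta, hB] at this
      refine mul_left_cancel₀ hp ?_
      rw [toPlane_apply] at this
      linarith
    have e1' := mul_left_cancel₀ hp e1
    rw [e0, e1', e2, e3, e4, hK, h1, h2, dρ_add, add_apply, dρ_mulρ, mulρ_apply, hNg, dζ_mulρ,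
      hB] at hA
    refine mul_left_cancel₀ hp ?_
    simp only [add_apply, sub_apply, smul_apply, smul_eq_mul]
    linarith
  intro p
  have := DFunLike.congr_fun key p
  simpa using this

end SpaceSchwartz

namespace SpaceSchwartz

open LineDeriv SchwartzMap PlaneSchwartz

/-- The components of a Schwartz vector field. -/
def component (u : SchwartzMap E3 E3) (i : Fin 3) : SchwartzMap E3 ℝ :=
  postcompCLM (EuclideanSpace.proj i : E3 →L[ℝ] ℝ) u

lemma component_apply (u : SchwartzMap E3 E3) (i : Fin 3) (x : E3) : component u i x = u x i := rfl

lemma coe_component (u : SchwartzMap E3 E3) (i : Fin 3) :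
    (⇑(component u i) : E3 → ℝ) = fun x => u x i := rfl

/-- The second vorticity component as a Schwartz function. -/
def vorticityTwo (u : SchwartzMap E3 E3) : SchwartzMap E3 ℝ :=
  partialS 2 (component u 0) - partialS 0 (component u 2)

lemma vorticityTwo_apply (u : SchwartzMap E3 E3) (x : E3) : vorticityTwo u x = omega2 u x := by
  simp only [vorticityTwo, sub_apply, partialS_apply, omega2, coe_component]

/-- Axisymmetry of a Schwartz vector field. -/
def IsAxisymmetric (u : SchwartzMap E3 E3) : Prop := ∀ θ x, u (rotZ θ x) = rotZ θ (u x)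

namespace IsAxisymmetric

variable {u : SchwartzMap E3 E3}

lemma rotate_component_zero (hu : IsAxisymmetric u) (φ : ℝ) :
    rotate φ (component u 0) = cos φ • component u 0 - sin φ • component u 1 := by
  ext x
  simp [component_apply, hu φ x, rotZ_zero, mul_comm]

lemma rotate_component_one (hu : IsAxisymmetric u) (φ : ℝ) :
    rotate φ (component u 1) = sin φ • component u 0 + cos φ • component u 1 := by
  ext x
  simp [component_apply, hu φ x, rotZ_one, mul_comm]

lemma rotate_component_two (hu : IsAxisymmetric u) (φ : ℝ) : rotate φ (component u 2) = component u 2 := by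
  ext x
  simp [component_apply, hu φ x, rotZ_two]

lemma isHorizontal_component_zero (hu : IsAxisymmetric u) : IsHorizontal (component u 0) := fun φ => by
  rw [hu.rotate_component_zero, hu.rotate_component_zero, cos_neg, sin_neg]
  module

lemma omega2_rotZ (hu : IsAxisymmetric u) (φ : ℝ) (x : E3) :
    omega2 u (rotZ φ x) = sin φ * omega1 u x + cos φ * omega2 u x := by
  have h1 : partialS 2 (component u 0) (rotZ φ x)
      = cos φ * partialS 2 (component u 0) x - sin φ * partialS 2 (component u 1) x := by
    have e : partialS 2 (rotate φ (component u 0)) = rotate φ (partialS 2 (component u 0)) :=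
      partialS_two_rotate φ _
    rw [hu.rotate_component_zero] at e
    have := DFunLike.congr_fun e x
    simp only [partialS, sub_eq_add_neg, lineDerivOp_add, lineDerivOp_neg, lineDerivOp_smul,
      add_apply, neg_apply, smul_apply, smul_eq_mul, rotate_apply] at this
    simp only [partialS]
    linarith
  have h2 : ∀ i, partialS i (component u 2) x
      = fderiv ℝ (component u 2) (rotZ φ x) (rotZ φ (basisVec i)) := fun i => by
    rw [← pd_rotate, hu.rotate_component_two]
  have h20 := h2 0
  have h21 := h2 1
  rw [fderiv_apply_eq] at h20 h21
  simp only [rotZ_zero, rotZ_one, rotZ_two, basisVec, PiLp.single_apply] at h20 h21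
  simp at h20 h21
  have e2 : ∀ y, omega2 u y = partialS 2 (component u 0) y - partialS 0 (component u 2) y :=
    fun y => by simp only [omega2, partialS_apply, coe_component]
  have e1 : omega1 u x = partialS 1 (component u 2) x - partialS 2 (component u 1) x := by
    simp only [omega1, partialS_apply, coe_component]
  rw [e2, e2, e1, h1, h20, h21]
  linear_combination partialS 0 (component u 2) (rotZ φ x) * sin_sq_add_cos_sq φ

lemma isHorizontal_vorticityTwo (hu : IsAxisymmetric u) : IsHorizontal (vorticityTwo u) := fun φ => by
  ext x
  simp only [add_apply, rotate_apply, vorticityTwo_apply, hu.omega2_rotZ, cos_neg, sin_neg,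
    smul_apply, smul_eq_mul]
  ring

lemma partialS_one_component_one (hu : IsAxisymmetric u) (p : ℝ × ℝ) :
    p.1 * toPlane (partialS 1 (component u 1)) p = toPlane (component u 0) p := by
  have h0 : rotZ 0 (planeEmb p) = planeEmb p := by
    apply ext_three <;> simp [rotZ_zero, rotZ_one, rotZ_two]
  have h := hasDerivAt_rotZ (component u 1) p.1 p.2 0
  have e : (fun φ => component u 1 (rotZ φ (planeEmb (p.1, p.2)))) = fun φ =>
      sin φ * component u 0 (planeEmb p) + cos φ * component u 1 (planeEmb p) := by
    ext φ
    simpa using DFunLike.congr_fun (hu.rotate_component_one φ) (planeEmb p)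
  rw [e, Prod.mk.eta, h0] at h
  have h' := ((hasDerivAt_sin 0).mul_const (component u 0 (planeEmb p))).fun_add
    ((hasDerivAt_cos 0).mul_const (component u 1 (planeEmb p)))
  have := h.unique h'
  simpa [toPlane_apply] using this

end IsAxisymmetric

lemma exists_rotZ_planeEmb_eq {x : E3} :
    ∃ φ, x = rotZ φ (planeEmb (rr x, x 2)) := by
  set w : ℂ := ⟨x 0, x 1⟩ with hw
  have hn : ‖w‖ = rr x := by
    rw [Complex.norm_def, rr, Complex.normSq_mk]
    congr 1
    ring
  refine ⟨w.arg, ext_three ?_ ?_ ?_⟩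
  · simp [rotZ_zero, ← hn, hw]
  · simp [rotZ_one, ← hn, hw]
  · simp [rotZ_two]

/-- The meridional profiles of an axisymmetric divergence-free Schwartz field. -/
lemma exists_profiles {u : SchwartzMap E3 E3} (hu : IsAxisymmetric u)
    (hdiv : ∀ x : E3, (∑ i : Fin 3, pd (fun y => u y i) i x) = 0) :
    ∃ K B G : PlaneSchwartz, (∀ p, dρ K p = p.1 * B p) ∧
      (∀ p, dρ (dρ K) p + 3 * B p + dζ (dζ K) p = dζ G p) ∧
      (∀ p, toPlane (vorticityTwo u) p = p.1 * G p) ∧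
      ∀ x, 0 < rr x → urr u x = K (rr x, x 2) ∧ GammaOf u x = G (rr x, x 2) := by
  obtain ⟨K, B, hK, hB⟩ :=
    exists_mul_fst_eq_of_odd hu.isHorizontal_component_zero.toPlane_neg
  obtain ⟨G, -, hG, -⟩ :=
    exists_mul_fst_eq_of_odd hu.isHorizontal_vorticityTwo.toPlane_neg
  refine ⟨K, B, G, hB, ?_, hG, ?_⟩
  · have hP : toPlane (component u 0) = mulρ K := by ext p; simp [hK]
    set Q := toPlane (component u 2) with hQ
    have hdQ : dζ Q = -((2 : ℝ) • K + mulρ (dρ K)) := by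
      refine eq_of_mul_fst_eq fun p hp => ?_
      have h := hdiv (planeEmb p)
      simp only [Fin.sum_univ_three, ← coe_component, ← partialS_apply] at h
      have e0 : partialS 0 (component u 0) (planeEmb p) = dρ (toPlane (component u 0)) p := by
        rw [dρ_toPlane]; rfl
      have e2 : partialS 2 (component u 2) (planeEmb p) = dζ Q p := by
        rw [hQ, dζ_toPlane]; rfl
      have e1 := hu.partialS_one_component_one p
      rw [toPlane_apply, hP, mulρ_apply] at e1
      have e1' := mul_left_cancel₀ hp e1
      rw [e0, e1', e2, hP, dρ_mulρ] at h
      simp only [neg_apply, add_apply, smul_apply, smul_eq_mul, mulρ_apply]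
      linarith
    have hGm : mulρ G = mulρ (dζ K) - dρ Q := by
      have e : mulρ G = toPlane (vorticityTwo u) := by ext p; simp [hG]
      have e0 : dζ (toPlane (component u 0)) = mulρ (dζ K) := by
        ext p
        rw [hP, dζ_mulρ, mulρ_apply]
      rw [e, ← e0, dζ_toPlane, hQ, dρ_toPlane]
      rfl
    have key : dρ (dρ K) + (3 : ℝ) • B + dζ (dζ K) = dζ G := by
      refine eq_of_mul_fst_eq fun p hp => mul_left_cancel₀ hp ?_
      have h := DFunLike.congr_fun (congrArg dζ hGm) p
      rw [dζ_mulρ, dζ_sub, sub_apply, dζ_mulρ, ← dρ_dζ, hdQ] at h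
      have e : dρ (-((2 : ℝ) • K + mulρ (dρ K))) = -((2 : ℝ) • dρ K + dρ (mulρ (dρ K))) := by
        rw [← dρ_smul, ← dρ_add]
        exact lineDerivOp_neg _ _
      rw [e] at h
      simp only [neg_apply, add_apply, smul_apply, smul_eq_mul, dρ_mulρ, hB] at h
      simp only [add_apply, smul_apply, smul_eq_mul]
      linarith
    intro p
    simpa using DFunLike.congr_fun key p
  · intro x hx
    obtain ⟨φ, hφ⟩ := exists_rotZ_planeEmb_eq (x := x)
    set y := planeEmb (rr x, x 2) with hy
    have hx0 : x 0 = rr x * cos φ := by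
      conv_lhs => rw [hφ]
      simp [rotZ_zero, hy]
    have hx1 : x 1 = rr x * sin φ := by
      conv_lhs => rw [hφ]
      simp [rotZ_one, hy]
    have hs := sin_sq_add_cos_sq φ
    constructor
    · have h0 : u x 0 = u y 0 * cos φ - u y 1 * sin φ := by
        conv_lhs => rw [hφ, hu]
        exact rotZ_zero _ _
      have h1 : u x 1 = u y 0 * sin φ + u y 1 * cos φ := by
        conv_lhs => rw [hφ, hu]
        exact rotZ_one _ _
      have h2 : u y 0 = rr x * K (rr x, x 2) := hK (rr x, x 2)
      rw [urr, div_div, div_eq_iff (by positivity), hx0, hx1, h0, h1]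
      linear_combination rr x * u y 0 * hs + rr x * h2
    · have h1 : omega2 u x = sin φ * omega1 u y + cos φ * omega2 u y := by
        conv_lhs => rw [hφ]
        exact hu.omega2_rotZ φ y
      have h2 : omega2 u y = -sin φ * omega1 u x + cos φ * omega2 u x := by
        have := hu.omega2_rotZ (-φ) x
        rw [cos_neg, sin_neg] at this
        rw [← this]
        conv_rhs => rw [hφ, rotZ_neg_rotZ]
      have h3 : omega2 u y = rr x * G (rr x, x 2) := by
        rw [← hG (rr x, x 2), toPlane_apply, vorticityTwo_apply]
      rw [GammaOf, div_div, div_eq_iff (by positivity), hx0, hx1]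
      linear_combination -rr x * h2 + rr x * h3

end SpaceSchwartz

namespace PlaneSchwartz

open LineDeriv SchwartzMap

/-- Multiplication by a function of the second variable. -/
def mulζ (w : ℝ → ℝ) (f : PlaneSchwartz) : PlaneSchwartz :=
  smulLeftCLM ℝ (fun p : ℝ × ℝ => w p.2) f

lemma mulζ_apply {w : ℝ → ℝ} (hw : w.HasTemperateGrowth) (f : PlaneSchwartz) (p : ℝ × ℝ) :
    mulζ w f p = w p.2 * f p := by
  exact smulLeftCLM_apply_apply (hw.comp snd_hasTemperateGrowth) f p

lemma dρ_mulζ {w : ℝ → ℝ} (hw : w.HasTemperateGrowth) (f : PlaneSchwartz) :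
    dρ (mulζ w f) = mulζ w (dρ f) := by
  ext p
  rw [mulζ_apply hw]
  refine dρ_eq_of_hasDerivAt ?_
  simpa only [mulζ_apply hw] using (hasDerivAt_fst f p.1 p.2).const_mul (w p.2)

lemma dζ_mulζ {w : ℝ → ℝ} (hw : w.HasTemperateGrowth) {w' : ℝ} (f : PlaneSchwartz) {p : ℝ × ℝ}
    (hd : HasDerivAt w w' p.2) : dζ (mulζ w f) p = w' * f p + w p.2 * dζ f p := by
  refine dζ_eq_of_hasDerivAt ?_
  simpa only [mulζ_apply hw] using hd.fun_mul (hasDerivAt_snd f p.1 p.2)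

/-- The weight `1 / (1 + (z - z₀)²)`. -/
def weight (z₀ z : ℝ) : ℝ := (1 + (z - z₀) ^ 2)⁻¹

lemma weight_pos (z₀ z : ℝ) : 0 < weight z₀ z := by unfold weight; positivity

lemma weight_mul (z₀ z : ℝ) : weight z₀ z * (1 + (z - z₀) ^ 2) = 1 :=
  inv_mul_cancel₀ (by positivity)

lemma weight_le_one (z₀ z : ℝ) : weight z₀ z ≤ 1 := by
  have := weight_mul z₀ z
  have := mul_nonneg (weight_pos z₀ z).le (sq_nonneg (z - z₀))
  linarith

lemma continuous_weight (z₀ : ℝ) : Continuous (weight z₀) := by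
  unfold weight
  exact Continuous.inv₀ (by fun_prop) fun z => by positivity

lemma sub_hasTemperateGrowth (z₀ : ℝ) : (fun z : ℝ => z - z₀).HasTemperateGrowth :=
  Function.HasTemperateGrowth.id'.sub (.const z₀)

lemma weight_hasTemperateGrowth (z₀ : ℝ) : (weight z₀).HasTemperateGrowth := by
  have := (Function.hasTemperateGrowth_one_add_norm_sq_rpow ℝ (-1)).comp
    (sub_hasTemperateGrowth z₀)
  refine (funext fun z => ?_ : weight z₀ = _) ▸ this
  simp [weight, rpow_neg_one]

lemma sub_mul_weight_hasTemperateGrowth (z₀ : ℝ) :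
    (fun z => (z - z₀) * weight z₀ z).HasTemperateGrowth :=
  (sub_hasTemperateGrowth z₀).mul (weight_hasTemperateGrowth z₀)

lemma hasDerivAt_weight (z₀ z : ℝ) :
    HasDerivAt (weight z₀) (-(2 * (z - z₀) * weight z₀ z ^ 2)) z := by
  have h := ((((hasDerivAt_id z).sub_const z₀).fun_pow 2).const_add 1).fun_inv
    (by simp only [id]; positivity)
  refine h.congr_deriv ?_
  simp only [weight, id]
  field_simp
  simp
  ring

lemma hasDerivAt_sub_mul_weight (z₀ z : ℝ) :
    HasDerivAt (fun z => (z - z₀) * weight z₀ z)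
      (weight z₀ z - 2 * (z - z₀) ^ 2 * weight z₀ z ^ 2) z :=
  (((hasDerivAt_id z).sub_const z₀).fun_mul (hasDerivAt_weight z₀ z)).congr_deriv
    (by simp only [id]; ring)

/-- The weighted energy. -/
def weightedEnergy (z₀ : ℝ) (f : PlaneSchwartz) : ℝ :=
  ∫ p in halfPlane, weight z₀ p.2 * (p.1 * f p ^ 2)

lemma integrableOn_weight_mul_sq (z₀ : ℝ) (f : PlaneSchwartz) :
    IntegrableOn (fun p : ℝ × ℝ => weight z₀ p.2 * (p.1 * f p ^ 2)) halfPlane := by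
  refine (integrableOn_mul_sq f).bdd_mul (c := 1)
    ((continuous_weight z₀).comp continuous_snd).aestronglyMeasurable (ae_of_all _ fun p => ?_)
  rw [norm_of_nonneg (weight_pos z₀ p.2).le]
  exact weight_le_one z₀ p.2

lemma energy_add_le (f g : PlaneSchwartz) : energy (f + g) ≤ 2 * (energy f + energy g) := by
  simp only [energy]
  rw [← integral_add (integrableOn_mul_sq f) (integrableOn_mul_sq g), ← integral_const_mul]
  refine setIntegral_mono_on (integrableOn_mul_sq _)
    (((integrableOn_mul_sq f).add (integrableOn_mul_sq g)).const_mul 2) measurableSet_halfPlane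
    fun p hp => ?_
  have hr : 0 ≤ p.1 := le_of_lt hp
  have := mul_nonneg hr (sq_nonneg (f p - g p))
  simp only [add_apply]
  linarith

lemma energy_smul (c : ℝ) (f : PlaneSchwartz) : energy (c • f) = c ^ 2 * energy f := by
  simp only [energy]
  rw [← integral_const_mul]
  congr 1
  ext p
  simp only [smul_apply, smul_eq_mul]
  ring

lemma weightedEnergy_le {z₀ : ℝ} {h a b c d : PlaneSchwartz}
    (H : ∀ p, weight z₀ p.2 * h p ^ 2 ≤ 4 * (a p ^ 2 + b p ^ 2 + c p ^ 2 + d p ^ 2)) :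
    weightedEnergy z₀ h ≤ 4 * (energy a + energy b + energy c + energy d) := by
  have ia := integrableOn_mul_sq a
  have ib := integrableOn_mul_sq b
  have ic := integrableOn_mul_sq c
  have id := integrableOn_mul_sq d
  have iab : IntegrableOn (fun p : ℝ × ℝ => p.1 * a p ^ 2 + p.1 * b p ^ 2) halfPlane := ia.add ib
  have iabc : IntegrableOn (fun p : ℝ × ℝ => p.1 * a p ^ 2 + p.1 * b p ^ 2 + p.1 * c p ^ 2)
    halfPlane := iab.add ic
  simp only [energy, weightedEnergy]
  rw [← integral_add ia ib, ← integral_add iab ic, ← integral_add iabc id, ← integral_const_mul]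
  refine setIntegral_mono_on (integrableOn_weight_mul_sq z₀ h)
    ((iabc.add id).const_mul 4) measurableSet_halfPlane fun p hp => ?_
  have := mul_le_mul_of_nonneg_left (H p) (le_of_lt hp)
  linarith

lemma energy_le_weightedEnergy {z₀ C : ℝ} {h a b : PlaneSchwartz}
    (H : ∀ p, h p ^ 2 ≤ C * (weight z₀ p.2 * (a p ^ 2 + b p ^ 2))) :
    energy h ≤ C * (weightedEnergy z₀ a + weightedEnergy z₀ b) := by
  have ia := integrableOn_weight_mul_sq z₀ a
  have ib := integrableOn_weight_mul_sq z₀ b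
  simp only [energy, weightedEnergy]
  rw [← integral_add ia ib, ← integral_const_mul]
  refine setIntegral_mono_on (integrableOn_mul_sq h)
    ((ia.add ib).const_mul C) measurableSet_halfPlane fun p hp => ?_
  have := mul_le_mul_of_nonneg_left (H p) (le_of_lt hp)
  linarith

lemma sq_sub_le (a b c d : ℝ) :
    (a + b + c - d) ^ 2 ≤ 4 * (a ^ 2 + b ^ 2 + c ^ 2 + d ^ 2) := by
  nlinarith [sq_nonneg (a - b), sq_nonneg (a - c), sq_nonneg (a + d), sq_nonneg (b - c),
    sq_nonneg (b + d), sq_nonneg (c + d)]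

lemma weight_mul_sq_le (z₀ z a b c d : ℝ) :
    weight z₀ z * ((z - z₀) * a + b + c - d) ^ 2 ≤ 4 * (a ^ 2 + b ^ 2 + c ^ 2 + d ^ 2) := by
  have h1 := mul_le_mul_of_nonneg_left (sq_sub_le ((z - z₀) * a) b c d) (weight_pos z₀ z).le
  have h2 := weight_mul z₀ z
  have h3 := weight_le_one z₀ z
  have h4 := weight_pos z₀ z
  have h5 : weight z₀ z * ((z - z₀) * a) ^ 2 ≤ a ^ 2 := by
    have : weight z₀ z * ((z - z₀) * a) ^ 2 = a ^ 2 - weight z₀ z * a ^ 2 := by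
      linear_combination a ^ 2 * h2
    have := mul_nonneg h4.le (sq_nonneg a)
    linarith
  have h6 := mul_le_of_le_one_left (add_nonneg (add_nonneg (sq_nonneg b) (sq_nonneg c)) (sq_nonneg d)) h3
  linarith

/-- The weighted second order estimate for the regularized problem. -/
lemma weightedEnergy_regularized_le {z₀ ε : ℝ} (hε : 0 ≤ ε)
    {f B G k₁ B₁ g₁ k₀ B₀ g₀ : PlaneSchwartz}
    (hB : ∀ p, dρ f p = p.1 * B p)
    (hf : ∀ p, dρ (dρ f) p + 3 * B p + dζ (dζ f) p = dζ G p)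
    (hB₁ : ∀ p, dρ k₁ p = p.1 * B₁ p)
    (hk₁ : ∀ p, dρ (dρ k₁) p + 3 * B₁ p + dζ (dζ k₁) p - ε * k₁ p = dζ g₁ p)
    (hB₀ : ∀ p, dρ k₀ p = p.1 * B₀ p)
    (hk₀ : ∀ p, dρ (dρ k₀) p + 3 * B₀ p + dζ (dζ k₀) p - ε * k₀ p = dζ g₀ p)
    (hG : G = mulζ (fun z => z - z₀) g₁ + g₀) :
    weightedEnergy z₀ (dρ (dρ f)) + weightedEnergy z₀ (dζ (dζ f))
        + 2 * weightedEnergy z₀ (dρ (dζ f)) ≤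
      4 * (energy (dζ g₁) + energy (dζ g₀) + 16 * energy g₁ + 4 * (ε ^ 2 * energy f)) := by
  have hw := sub_hasTemperateGrowth z₀
  have hd : ∀ z, HasDerivAt (fun z => z - z₀) 1 z := fun z => (hasDerivAt_id z).sub_const z₀
  have dz : ∀ h : PlaneSchwartz,
      dζ (mulζ (fun z => z - z₀) h) = h + mulζ (fun z => z - z₀) (dζ h) := fun h => by
    ext p
    rw [dζ_mulζ hw h (hd _), add_apply, mulζ_apply hw, one_mul]
  set e := mulζ (fun z => z - z₀) k₁ + k₀ - f with he
  set S := (2 : ℝ) • dζ k₁ + (ε • f - g₁) with hS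
  have hrr : dρ (dρ e) = mulζ (fun z => z - z₀) (dρ (dρ k₁)) + dρ (dρ k₀) - dρ (dρ f) := by
    simp only [he, dρ_add, dρ_sub, dρ_mulζ hw]
  have hrz : dρ (dζ e) = dρ k₁ + mulζ (fun z => z - z₀) (dρ (dζ k₁)) + dρ (dζ k₀)
      - dρ (dζ f) := by
    simp only [he, dρ_add, dρ_sub, dζ_add, dζ_sub, dρ_mulζ hw, dz]
  have hzz : dζ (dζ e) = dζ k₁ + (dζ k₁ + mulζ (fun z => z - z₀) (dζ (dζ k₁)))
      + dζ (dζ k₀) - dζ (dζ f) := by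
    simp only [he, dζ_add, dζ_sub, dz]
  have main := energy_second_order_le (K := e)
    (B := mulζ (fun z => z - z₀) B₁ + B₀ - B) (S := S) hε
    (fun p => by
      simp only [he, dρ_add, dρ_sub, dρ_mulζ hw, add_apply, sub_apply, mulζ_apply hw, hB, hB₁,
        hB₀]
      ring)
    (fun p => by
      have h1 := hf p
      rw [hG, dζ_add, dz] at h1
      rw [hrr, hzz]
      simp only [hS, he, add_apply, sub_apply, smul_apply, smul_eq_mul, mulζ_apply hw] at h1 ⊢
      linear_combination h1 - hk₀ p - (p.2 - z₀) * hk₁ p)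
  have hSle : energy S ≤ 2 * (4 * energy (dζ k₁) + 2 * (ε ^ 2 * energy f + energy g₁)) := by
    have h1 := energy_add_le ((2 : ℝ) • dζ k₁) (ε • f - g₁)
    have h2 := energy_add_le (ε • f) ((-1 : ℝ) • g₁)
    have h3 : ε • f + (-1 : ℝ) • g₁ = ε • f - g₁ := by module
    rw [h3] at h2
    simp only [energy_smul] at h1 h2
    rw [← hS] at h1
    linarith
  have a1 := energy_first_order_le hε hB₁ hk₁
  have a2 := energy_second_order_le hε hB₁ (fun p => (hk₁ p).symm)
  have a3 := energy_second_order_le hε hB₀ (fun p => (hk₀ p).symm)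
  have zero : energy 0 = 0 := by simp [energy]
  have brr : weightedEnergy z₀ (dρ (dρ f)) ≤
      4 * (energy (dρ (dρ k₁)) + energy (dρ (dρ k₀)) + energy 0 + energy (dρ (dρ e))) :=
    weightedEnergy_le fun p => by
      refine le_of_eq_of_le ?_ (weight_mul_sq_le z₀ p.2 _ _ _ _)
      rw [hrr]
      simp only [add_apply, sub_apply, mulζ_apply hw, zero_apply]
      ring
  have brz : weightedEnergy z₀ (dρ (dζ f)) ≤
      4 * (energy (dρ (dζ k₁)) + energy (dρ (dζ k₀)) + energy (dρ k₁) + energy (dρ (dζ e))) :=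
    weightedEnergy_le fun p => by
      refine le_of_eq_of_le ?_ (weight_mul_sq_le z₀ p.2 _ _ _ _)
      rw [hrz]
      simp only [add_apply, sub_apply, mulζ_apply hw]
      ring
  have bzz : weightedEnergy z₀ (dζ (dζ f)) ≤
      4 * (energy (dζ (dζ k₁)) + energy (dζ (dζ k₀)) + energy ((2 : ℝ) • dζ k₁)
        + energy (dζ (dζ e))) :=
    weightedEnergy_le fun p => by
      refine le_of_eq_of_le ?_ (weight_mul_sq_le z₀ p.2 _ _ _ _)
      rw [hzz]
      simp only [add_apply, sub_apply, mulζ_apply hw, smul_apply, smul_eq_mul]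
      ring
  rw [energy_smul] at bzz
  have p1 := energy_nonneg B₁
  have p2 := energy_nonneg B₀
  have p3 := energy_nonneg (mulζ (fun z => z - z₀) B₁ + B₀ - B)
  have p4 := energy_nonneg (dρ k₁)
  have p5 := energy_nonneg (dζ k₁)
  have p6 := energy_nonneg g₁
  linarith

lemma energy_sub_mul_weight_le (z₀ : ℝ) (G : PlaneSchwartz) :
    energy (mulζ (fun z => (z - z₀) * weight z₀ z) G)
      ≤ 1 * (weightedEnergy z₀ G + weightedEnergy z₀ (dζ G)) :=
  energy_le_weightedEnergy fun p => by
    rw [mulζ_apply (sub_mul_weight_hasTemperateGrowth z₀)]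
    have h1 := weight_mul z₀ p.2
    have h2 := weight_pos z₀ p.2
    set w := weight z₀ p.2
    have e : 1 * (w * (G p ^ 2 + dζ G p ^ 2)) - ((p.2 - z₀) * w * G p) ^ 2
        = w ^ 2 * G p ^ 2 + w * dζ G p ^ 2 := by
      linear_combination -(w * G p ^ 2) * h1
    have : 0 ≤ w ^ 2 * G p ^ 2 + w * dζ G p ^ 2 := by positivity
    linarith

lemma energy_dζ_sub_mul_weight_le (z₀ : ℝ) (G : PlaneSchwartz) :
    energy (dζ (mulζ (fun z => (z - z₀) * weight z₀ z) G))
      ≤ 2 * (weightedEnergy z₀ G + weightedEnergy z₀ (dζ G)) :=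
  energy_le_weightedEnergy fun p => by
    rw [dζ_mulζ (sub_mul_weight_hasTemperateGrowth z₀) G (hasDerivAt_sub_mul_weight z₀ p.2)]
    have h1 := weight_mul z₀ p.2
    have h2 := weight_pos z₀ p.2
    have h3 := weight_le_one z₀ p.2
    set w := weight z₀ p.2
    set t := p.2 - z₀
    have c1 : (w - 2 * t ^ 2 * w ^ 2) ^ 2 ≤ w := by
      have e : w - 2 * t ^ 2 * w ^ 2 = w * (2 * w - 1) := by linear_combination (-2 * w) * h1
      have : (w * (2 * w - 1)) ^ 2 = w ^ 2 - 4 * w ^ 3 * (1 - w) := by ring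
      rw [e, this]
      have : 0 ≤ w ^ 3 * (1 - w) := mul_nonneg (by positivity) (by linarith)
      nlinarith
    have c2 : (t * w) ^ 2 ≤ w := by
      have : (t * w) ^ 2 = w - w ^ 2 := by linear_combination w * h1
      nlinarith [sq_nonneg w]
    have i1 := mul_le_mul_of_nonneg_right c1 (sq_nonneg (G p))
    have i2 := mul_le_mul_of_nonneg_right c2 (sq_nonneg (dζ G p))
    have i3 := sq_nonneg ((w - 2 * t ^ 2 * w ^ 2) * G p - t * w * dζ G p)
    linarith

lemma energy_dζ_weight_le (z₀ : ℝ) (G : PlaneSchwartz) :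
    energy (dζ (mulζ (weight z₀) G))
      ≤ 2 * (weightedEnergy z₀ G + weightedEnergy z₀ (dζ G)) :=
  energy_le_weightedEnergy fun p => by
    rw [dζ_mulζ (weight_hasTemperateGrowth z₀) G (hasDerivAt_weight z₀ p.2)]
    have h1 := weight_mul z₀ p.2
    have h2 := weight_pos z₀ p.2
    have h3 := weight_le_one z₀ p.2
    set w := weight z₀ p.2
    set t := p.2 - z₀
    have c1 : (-(2 * t * w ^ 2)) ^ 2 ≤ w := by
      have e : (-(2 * t * w ^ 2)) ^ 2 = w ^ 2 * (1 - (2 * w - 1) ^ 2) := by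
        linear_combination 4 * w ^ 3 * h1
      rw [e]
      have : 0 ≤ w ^ 2 * (2 * w - 1) ^ 2 := by positivity
      nlinarith
    have c2 : w ^ 2 ≤ w := by nlinarith
    have i1 := mul_le_mul_of_nonneg_right c1 (sq_nonneg (G p))
    have i2 := mul_le_mul_of_nonneg_right c2 (sq_nonneg (dζ G p))
    have i3 := sq_nonneg (-(2 * t * w ^ 2) * G p - w * dζ G p)
    linarith

end PlaneSchwartz

namespace SpaceSchwartz

open LineDeriv SchwartzMap PlaneSchwartz

lemma IsHorizontal.exists_smul {N : SchwartzMap E3 ℝ} (hN : IsHorizontal N) {w : ℝ → ℝ}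
    (hw : w.HasTemperateGrowth) :
    ∃ M : SchwartzMap E3 ℝ, IsHorizontal M ∧ toPlane M = mulζ w (toPlane N) := by
  have hx : (fun x : E3 => w (x 2)).HasTemperateGrowth :=
    hw.comp (EuclideanSpace.proj (2 : Fin 3) : E3 →L[ℝ] ℝ).hasTemperateGrowth
  refine ⟨smulLeftCLM ℝ (fun x : E3 => w (x 2)) N, fun φ => ?_, ?_⟩
  · ext x
    have := DFunLike.congr_fun (hN φ) x
    simp only [add_apply, rotate_apply, smul_apply, smul_eq_mul, smulLeftCLM_apply_apply hx,
      rotZ_two] at this ⊢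
    linear_combination w (x 2) * this
  · ext p
    rw [mulζ_apply hw, toPlane_apply, toPlane_apply, smulLeftCLM_apply_apply hx, planeEmb_two,
      smul_eq_mul]

/-- The weighted second order estimate for the stream profile. -/
lemma weightedEnergy_second_order_le {N : SchwartzMap E3 ℝ} (hN : IsHorizontal N)
    {f B G : PlaneSchwartz} (hB : ∀ p, dρ f p = p.1 * B p)
    (hf : ∀ p, dρ (dρ f) p + 3 * B p + dζ (dζ f) p = dζ G p)
    (hG : ∀ p, toPlane N p = p.1 * G p) (z₀ : ℝ) :
    weightedEnergy z₀ (dρ (dρ f)) + weightedEnergy z₀ (dζ (dζ f))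
        + 2 * weightedEnergy z₀ (dρ (dζ f)) ≤
      80 * (weightedEnergy z₀ G + weightedEnergy z₀ (dζ G)) := by
  have h₁ := sub_mul_weight_hasTemperateGrowth z₀
  have h₀ := weight_hasTemperateGrowth z₀
  obtain ⟨N₁, hN₁, e₁⟩ := hN.exists_smul h₁
  obtain ⟨N₀, hN₀, e₀⟩ := hN.exists_smul h₀
  have key : ∀ ε : ℝ, 0 < ε → weightedEnergy z₀ (dρ (dρ f)) + weightedEnergy z₀ (dζ (dζ f))
        + 2 * weightedEnergy z₀ (dρ (dζ f)) ≤
      80 * (weightedEnergy z₀ G + weightedEnergy z₀ (dζ G)) + 16 * energy f * ε ^ 2 := by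
    intro ε hε
    obtain ⟨k₁, B₁, hB₁, hk₁⟩ := exists_profile_solution hN₁
      (g := mulζ (fun z => (z - z₀) * weight z₀ z) G)
      (fun p => by rw [e₁, mulζ_apply h₁, mulζ_apply h₁, hG]; ring) hε
    obtain ⟨k₀, B₀, hB₀, hk₀⟩ := exists_profile_solution hN₀
      (g := mulζ (weight z₀) G) (fun p => by rw [e₀, mulζ_apply h₀, mulζ_apply h₀, hG]; ring) hε
    have := weightedEnergy_regularized_le hε.le hB hf hB₁ hk₁ hB₀ hk₀ (by
      ext p
      rw [add_apply, mulζ_apply (sub_hasTemperateGrowth z₀), mulζ_apply h₁, mulζ_apply h₀]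
      linear_combination -G p * weight_mul z₀ p.2)
    have b1 := energy_sub_mul_weight_le z₀ G
    have b2 := energy_dζ_sub_mul_weight_le z₀ G
    have b3 := energy_dζ_weight_le z₀ G
    linarith
  have ht : Tendsto (fun ε : ℝ => 80 * (weightedEnergy z₀ G + weightedEnergy z₀ (dζ G))
      + 16 * energy f * ε ^ 2) (𝓝[>] 0)
      (𝓝 (80 * (weightedEnergy z₀ G + weightedEnergy z₀ (dζ G)) + 16 * energy f * 0 ^ 2)) :=
    (Continuous.tendsto (by fun_prop) 0).mono_left nhdsWithin_le_nhds
  have := ge_of_tendsto ht (eventually_nhdsWithin_of_forall fun ε hε => key ε hε)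
  simpa using this

end SpaceSchwartz

namespace PlaneSchwartz

open LineDeriv SchwartzMap

/-- The energy in a horizontal strip of height `2`. -/
def localEnergy (y : ℝ) (h : PlaneSchwartz) : ℝ≥0∞ :=
  ∫⁻ p in halfPlane ∩ {p | p.2 ∈ Icc (y - 1) (y + 1)}, ENNReal.ofReal (p.1 * h p ^ 2)

lemma measurableSet_strip (y : ℝ) : MeasurableSet {p : ℝ × ℝ | p.2 ∈ Icc (y - 1) (y + 1)} :=
  measurable_snd measurableSet_Icc

lemma measurable_ofReal_mul_sq (h : PlaneSchwartz) :
    Measurable fun p : ℝ × ℝ => ENNReal.ofReal (p.1 * h p ^ 2) := by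
  have := h.continuous.measurable
  exact (measurable_fst.mul (this.pow_const 2)).ennreal_ofReal

lemma ofReal_weightedEnergy (z₀ : ℝ) (h : PlaneSchwartz) :
    ENNReal.ofReal (weightedEnergy z₀ h) = ∫⁻ p in halfPlane,
      ENNReal.ofReal (weight z₀ p.2) * ENNReal.ofReal (p.1 * h p ^ 2) := by
  rw [weightedEnergy, ofReal_integral_eq_lintegral_ofReal (integrableOn_weight_mul_sq z₀ h)]
  · simp_rw [ENNReal.ofReal_mul (weight_pos z₀ _).le]
  · filter_upwards [self_mem_ae_restrict measurableSet_halfPlane] with p hp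
    exact mul_nonneg (weight_pos z₀ p.2).le (mul_nonneg (le_of_lt hp) (sq_nonneg _))

lemma localEnergy_le (y : ℝ) (h : PlaneSchwartz) :
    localEnergy y h ≤ 2 * ENNReal.ofReal (weightedEnergy y h) := by
  rw [ofReal_weightedEnergy, ← lintegral_const_mul' _ _ (by simp), localEnergy]
  refine (setLIntegral_mono' (measurableSet_halfPlane.inter (measurableSet_strip y))
    fun p hp => ?_).trans (lintegral_mono_set inter_subset_left)
  rw [← mul_assoc]
  refine le_mul_of_one_le_left zero_le ?_
  have h1 := weight_mul y p.2
  have h2 := weight_pos y p.2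
  have h3 : (p.2 - y) ^ 2 ≤ 1 := by nlinarith [hp.2.1, hp.2.2]
  have h4 : 1 ≤ 2 * weight y p.2 := by nlinarith
  rw [← ENNReal.ofReal_ofNat 2, ← ENNReal.ofReal_mul (by norm_num)]
  exact ENNReal.one_le_ofReal.2 h4

lemma lintegral_weight (z₀ : ℝ) : ∫⁻ y, ENNReal.ofReal (weight z₀ y) = ENNReal.ofReal π := by
  have e : (fun y => ENNReal.ofReal (weight z₀ y)) =
    fun y => (fun t => ENNReal.ofReal ((1 + t ^ 2)⁻¹)) (y - z₀) := rfl
  rw [e, lintegral_sub_right_eq_self (fun t => ENNReal.ofReal ((1 + t ^ 2)⁻¹)),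
    ← integral_univ_inv_one_add_sq, ofReal_integral_eq_lintegral_ofReal integrable_inv_one_add_sq]
  exact ae_of_all _ fun t => by positivity

lemma weight_le_lintegral (z₀ z : ℝ) :
    ENNReal.ofReal (weight z₀ z) ≤
      3 * ∫⁻ y in {y | z ∈ Icc (y - 1) (y + 1)}, ENNReal.ofReal (weight z₀ y) := by
  have hs : {y | z ∈ Icc (y - 1) (y + 1)} = Icc (z - 1) (z + 1) := by
    ext y
    simp only [mem_ofPred_eq, mem_Icc]
    constructor <;> rintro ⟨h1, h2⟩ <;> constructor <;> linarith
  rw [hs, ← lintegral_const_mul' _ _ (by simp)]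
  calc ENNReal.ofReal (weight z₀ z)
      ≤ ∫⁻ _ in Icc (z - 1) (z + 1), ENNReal.ofReal (weight z₀ z) := by
        rw [setLIntegral_const, Real.volume_Icc]
        refine le_mul_of_one_le_right zero_le (ENNReal.one_le_ofReal.2 (by linarith))
    _ ≤ _ := by
        refine setLIntegral_mono' measurableSet_Icc fun y hy => ?_
        rw [← ENNReal.ofReal_ofNat 3, ← ENNReal.ofReal_mul (by norm_num)]
        refine ENNReal.ofReal_le_ofReal ?_
        have h1 : (y - z) ^ 2 ≤ 1 := by nlinarith [hy.1, hy.2]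
        have h2 : 1 + (y - z₀) ^ 2 ≤ 3 * (1 + (z - z₀) ^ 2) := by
          nlinarith [sq_nonneg ((y - z) - (z - z₀))]
        rw [weight, weight, ← div_eq_mul_inv, inv_eq_one_div, div_le_div_iff₀ (by positivity)
          (by positivity)]
        linarith

lemma ofReal_weightedEnergy_le (z₀ : ℝ) (h : PlaneSchwartz) :
    ENNReal.ofReal (weightedEnergy z₀ h) ≤ 3 * (ENNReal.ofReal π * ⨆ y, localEnergy y h) := by
  set D : Set ((ℝ × ℝ) × ℝ) := {q | q.1.2 ∈ Icc (q.2 - 1) (q.2 + 1)} with hD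
  have hDm : MeasurableSet D := by
    have h1 : MeasurableSet {q : (ℝ × ℝ) × ℝ | q.2 - 1 ≤ q.1.2} :=
      measurableSet_le (by fun_prop) (by fun_prop)
    have h2 : MeasurableSet {q : (ℝ × ℝ) × ℝ | q.1.2 ≤ q.2 + 1} :=
      measurableSet_le (by fun_prop) (by fun_prop)
    exact h1.inter h2
  set Φ : (ℝ × ℝ) → ℝ → ℝ≥0∞ := fun p y =>
    D.indicator (fun q => ENNReal.ofReal (weight z₀ q.2) * ENNReal.ofReal (q.1.1 * h q.1 ^ 2))
      (p, y) with hΦ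
  have hw : Measurable fun y => ENNReal.ofReal (weight z₀ y) :=
    (continuous_weight z₀).measurable.ennreal_ofReal
  have hΦm : Measurable (Function.uncurry Φ) :=
    ((hw.comp measurable_snd).mul ((measurable_ofReal_mul_sq h).comp measurable_fst)).indicator hDm
  have e1 : ∀ p, ∫⁻ y, Φ p y = (∫⁻ y in {y | p.2 ∈ Icc (y - 1) (y + 1)},
      ENNReal.ofReal (weight z₀ y)) * ENNReal.ofReal (p.1 * h p ^ 2) := fun p => by
    have hm : MeasurableSet {y | p.2 ∈ Icc (y - 1) (y + 1)} := measurable_prodMk_left (x := p) hDm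
    rw [← lintegral_mul_const _ hw, ← lintegral_indicator hm]
    rfl
  have e2 : ∀ y, ∫⁻ p in halfPlane, Φ p y = ENNReal.ofReal (weight z₀ y) * localEnergy y h :=
    fun y => by
    rw [localEnergy, inter_comm, ← Measure.restrict_restrict (measurableSet_strip y),
      ← lintegral_const_mul' _ _ ENNReal.ofReal_ne_top, ← lintegral_indicator
        (measurableSet_strip y)]
    rfl
  rw [ofReal_weightedEnergy]
  calc _ ≤ ∫⁻ p in halfPlane, 3 * ∫⁻ y, Φ p y := by
        refine lintegral_mono fun p => ?_
        rw [e1, ← mul_assoc]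
        gcongr
        exact weight_le_lintegral z₀ p.2
    _ = 3 * ∫⁻ y, ENNReal.ofReal (weight z₀ y) * localEnergy y h := by
        rw [lintegral_const_mul' _ _ (by simp), lintegral_lintegral_swap hΦm.aemeasurable]
        simp_rw [e2]
    _ ≤ 3 * ∫⁻ y, ENNReal.ofReal (weight z₀ y) * ⨆ y, localEnergy y h := by
        gcongr with y
        exact le_iSup (fun y => localEnergy y h) y
    _ = _ := by rw [lintegral_mul_const _ hw, lintegral_weight]

/-- The uniformly local second order estimate in the half-plane. -/
lemma localEnergy_second_order_le {a b c G H : PlaneSchwartz}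
    (hle : ∀ z₀, weightedEnergy z₀ a + weightedEnergy z₀ b + 2 * weightedEnergy z₀ c ≤
      80 * (weightedEnergy z₀ G + weightedEnergy z₀ H)) (y : ℝ) :
    localEnergy y a + localEnergy y b + 2 * localEnergy y c ≤
      480 * ENNReal.ofReal π * ((⨆ y, localEnergy y G) + ⨆ y, localEnergy y H) := by
  have hn : ∀ f, 0 ≤ weightedEnergy y f := fun f =>
    setIntegral_nonneg measurableSet_halfPlane fun p hp =>
      mul_nonneg (weight_pos y p.2).le (mul_nonneg (le_of_lt hp) (sq_nonneg _))
  calc localEnergy y a + localEnergy y b + 2 * localEnergy y c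
      ≤ 2 * ENNReal.ofReal (weightedEnergy y a) + 2 * ENNReal.ofReal (weightedEnergy y b)
        + 2 * (2 * ENNReal.ofReal (weightedEnergy y c)) := by
        gcongr <;> exact localEnergy_le y _
    _ = 2 * ENNReal.ofReal (weightedEnergy y a + weightedEnergy y b + 2 * weightedEnergy y c) := by
        have := hn a; have := hn b; have := hn c
        rw [ENNReal.ofReal_add (by positivity) (by positivity),
          ENNReal.ofReal_add (by positivity) (by positivity),
          ENNReal.ofReal_mul (by norm_num), ENNReal.ofReal_ofNat]
        ring
    _ ≤ 2 * ENNReal.ofReal (80 * (weightedEnergy y G + weightedEnergy y H)) := by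
        gcongr
        exact hle y
    _ = 160 * (ENNReal.ofReal (weightedEnergy y G) + ENNReal.ofReal (weightedEnergy y H)) := by
        rw [ENNReal.ofReal_mul (by norm_num), ENNReal.ofReal_add (hn G) (hn H),
          ENNReal.ofReal_ofNat, ← mul_assoc]
        norm_num
    _ ≤ 160 * (3 * (ENNReal.ofReal π * ⨆ y, localEnergy y G)
          + 3 * (ENNReal.ofReal π * ⨆ y, localEnergy y H)) := by
        gcongr <;> exact ofReal_weightedEnergy_le y _
    _ = _ := by ring

end PlaneSchwartz

namespace SpaceSchwartz

open LineDeriv SchwartzMap PlaneSchwartz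

lemma measurePreserving_coords :
    MeasurePreserving (fun x : E3 => (x 2, (x 0, x 1))) volume volume :=
  ((MeasurePreserving.id (volume : Measure ℝ)).prod (volume_preserving_finTwoArrow ℝ)).comp
    ((volume_preserving_piFinSuccAbove (fun _ => ℝ) 2).comp (PiLp.volume_preserving_ofLp (Fin 3)))

lemma lintegral_radial {F : ℝ → ℝ≥0∞} (hF : Measurable F) :
    ∫⁻ v : ℝ × ℝ, F √(v.1 ^ 2 + v.2 ^ 2)
      = ENNReal.ofReal (2 * π) * ∫⁻ r in Ioi 0, ENNReal.ofReal r * F r := by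
  rw [← lintegral_comp_polarCoord_symm]
  have e : ∫⁻ p in polarCoord.target, ENNReal.ofReal p.1 •
        F √((polarCoord.symm p).1 ^ 2 + (polarCoord.symm p).2 ^ 2)
      = ∫⁻ p in Ioi (0 : ℝ) ×ˢ Ioo (-π) π, ENNReal.ofReal p.1 * F p.1 := by
    refine setLIntegral_congr_fun polarCoord.open_target.measurableSet fun p hp => ?_
    have h0 : 0 ≤ p.1 := le_of_lt hp.1
    have h1 : (polarCoord.symm p).1 ^ 2 + (polarCoord.symm p).2 ^ 2 = p.1 ^ 2 := by
      simp only [polarCoord_symm_apply]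
      linear_combination p.1 ^ 2 * cos_sq_add_sin_sq p.2
    simp only [h1, sqrt_sq h0, smul_eq_mul]
  have hm : Measurable fun r : ℝ => ENNReal.ofReal r * F r :=
    ENNReal.measurable_ofReal.mul hF
  have hm' : Measurable fun p : ℝ × ℝ => ENNReal.ofReal p.1 * F p.1 := hm.comp measurable_fst
  rw [e, Measure.volume_eq_prod, ← Measure.prod_restrict,
    lintegral_prod _ hm'.aemeasurable]
  simp only [lintegral_const, Measure.restrict_apply MeasurableSet.univ, univ_inter,
    Real.volume_Ioo]
  rw [lintegral_mul_const _ hm, mul_comm]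
  congr 2
  ring

lemma lintegral_cylindrical {F : ℝ × ℝ → ℝ≥0∞} (hF : Measurable F) :
    ∫⁻ x : E3, F (rr x, x 2)
      = ENNReal.ofReal (2 * π) * ∫⁻ p in halfPlane, ENNReal.ofReal p.1 * F p := by
  have hm : Measurable fun q : ℝ × (ℝ × ℝ) => F (√(q.2.1 ^ 2 + q.2.2 ^ 2), q.1) :=
    hF.comp (by fun_prop)
  have hm' : Measurable fun p : ℝ × ℝ => ENNReal.ofReal p.1 * F p :=
    (ENNReal.measurable_ofReal.comp measurable_fst).mul hF
  rw [show (∫⁻ x : E3, F (rr x, x 2)) = _ from measurePreserving_coords.lintegral_comp hm,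
    Measure.volume_eq_prod, lintegral_prod _ hm.aemeasurable, restrict_halfPlane,
    lintegral_prod_symm' _ hm']
  simp_rw [fun z => lintegral_radial (F := fun r => F (r, z)) (hF.comp measurable_prodMk_right)]
  rw [lintegral_const_mul' _ _ ENNReal.ofReal_ne_top]

/-- The intersection of `{r > 0}` with a slab of height `2`. -/
def slab (y : ℝ) : Set E3 := {x | 0 < rr x} ∩ {x | x 2 ∈ Icc (y - 1) (y + 1)}

lemma continuous_rr : Continuous rr := by
  unfold rr
  fun_prop

lemma measurableSet_slab (y : ℝ) : MeasurableSet (slab y) :=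
  (measurableSet_lt measurable_const continuous_rr.measurable).inter
    ((by fun_prop : Measurable fun x : E3 => x 2) measurableSet_Icc)

lemma lintegral_slab_sq (y : ℝ) (h : PlaneSchwartz) :
    ∫⁻ x in slab y, ENNReal.ofReal (h (rr x, x 2) ^ 2)
      = ENNReal.ofReal (2 * π) * localEnergy y h := by
  set D : Set (ℝ × ℝ) := halfPlane ∩ {p | p.2 ∈ Icc (y - 1) (y + 1)} with hD
  have hDm : MeasurableSet D := measurableSet_halfPlane.inter (measurableSet_strip y)
  have hm : Measurable fun p : ℝ × ℝ => ENNReal.ofReal (h p ^ 2) :=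
    (h.continuous.measurable.pow_const 2).ennreal_ofReal
  have key := lintegral_cylindrical (hm.indicator hDm)
  rw [← lintegral_indicator (measurableSet_slab y)]
  refine Eq.trans ?_ (key.trans ?_)
  · rfl
  · rw [localEnergy, ← hD]
    congr 1
    have e : (fun p : ℝ × ℝ => ENNReal.ofReal p.1 *
        D.indicator (fun p => ENNReal.ofReal (h p ^ 2)) p)
        = D.indicator fun p => ENNReal.ofReal p.1 * ENNReal.ofReal (h p ^ 2) := by
      ext p
      by_cases hp : p ∈ D <;> simp [hp]
    rw [e, lintegral_indicator hDm, Measure.restrict_restrict hDm,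
      inter_eq_self_of_subset_left inter_subset_left]
    refine setLIntegral_congr_fun hDm fun p hp => ?_
    exact (ENNReal.ofReal_mul (le_of_lt hp.1)).symm

end SpaceSchwartz

namespace SpaceSchwartz

open LineDeriv SchwartzMap PlaneSchwartz

lemma hasFDerivAt_coord (i : Fin 3) (x : E3) :
    HasFDerivAt (fun y : E3 => y i) (EuclideanSpace.proj i : E3 →L[ℝ] ℝ) x :=
  (EuclideanSpace.proj i : E3 →L[ℝ] ℝ).hasFDerivAt

lemma rr_sq (x : E3) : rr x ^ 2 = x 0 ^ 2 + x 1 ^ 2 := sq_sqrt (by positivity)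

/-- The derivative of the distance to the axis. -/
def radialCovector (x : E3) : E3 →L[ℝ] ℝ :=
  (rr x)⁻¹ • (x 0 • (EuclideanSpace.proj 0 : E3 →L[ℝ] ℝ)
    + x 1 • (EuclideanSpace.proj 1 : E3 →L[ℝ] ℝ))

lemma radialCovector_apply (x v : E3) :
    radialCovector x v = (rr x)⁻¹ * (x 0 * v 0 + x 1 * v 1) := by
  simp [radialCovector]
  ring

lemma hasFDerivAt_rr {x : E3} (hx : 0 < rr x) : HasFDerivAt rr (radialCovector x) x := by
  have h1 := ((hasFDerivAt_coord 0 x).pow 2).fun_add ((hasFDerivAt_coord 1 x).pow 2)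
  have h0 : x 0 ^ 2 + x 1 ^ 2 ≠ 0 := by
    rw [← rr_sq]
    positivity
  refine (h1.sqrt h0).congr_fderiv ?_
  ext v
  rw [radialCovector_apply]
  have : √(x 0 ^ 2 + x 1 ^ 2) = rr x := rfl
  rw [this]
  simp
  field_simp

lemma norm_radialCovector_le {x : E3} (hx : 0 < rr x) : ‖radialCovector x‖ ≤ 1 := by
  refine ContinuousLinearMap.opNorm_le_bound _ zero_le_one fun v => ?_
  rw [one_mul, radialCovector_apply, norm_eq_abs]
  refine abs_le_of_sq_le_sq ?_ (norm_nonneg v)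
  rw [EuclideanSpace.norm_sq_eq, Fin.sum_univ_three, mul_pow, inv_pow, inv_mul_le_iff₀ (by positivity),
    rr_sq]
  simp only [norm_eq_abs, sq_abs]
  have := mul_nonneg (add_nonneg (sq_nonneg (x 0)) (sq_nonneg (x 1))) (sq_nonneg (v 2))
  nlinarith [sq_nonneg (x 0 * v 1 - x 1 * v 0)]

/-- `K` is the meridional profile of the axially symmetric function `g`. -/
def IsProfile (g : E3 → ℝ) (K : PlaneSchwartz) : Prop := ∀ x, 0 < rr x → g x = K (rr x, x 2)

namespace IsProfile

variable {g : E3 → ℝ} {K : PlaneSchwartz}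

lemma hasFDerivAt (hg : IsProfile g K) {x : E3} (hx : 0 < rr x) :
    HasFDerivAt g (dρ K (rr x, x 2) • radialCovector x
      + dζ K (rr x, x 2) • (EuclideanSpace.proj 2 : E3 →L[ℝ] ℝ)) x := by
  have h := (hasFDerivAt' K (rr x, x 2)).comp x ((hasFDerivAt_rr hx).prodMk (hasFDerivAt_coord 2 x))
  have hev : g =ᶠ[𝓝 x] fun y => K (rr y, y 2) := by
    filter_upwards [(isOpen_lt continuous_const continuous_rr).mem_nhds hx] with y hy
    exact hg y hy
  refine (h.congr_of_eventuallyEq hev).congr_fderiv ?_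
  ext v
  simp

lemma radial (hg : IsProfile g K) : IsProfile (dr g) (dρ K) := fun x hx => by
  rw [dr, pd, pd, (hg.hasFDerivAt hx).fderiv]
  simp only [add_apply, smul_apply, radialCovector_apply, smul_eq_mul, PiLp.proj_apply,
    PiLp.single_apply]
  simp
  field_simp
  linear_combination -dρ K (rr x, x 2) * rr_sq x

lemma vertical (hg : IsProfile g K) : IsProfile (fun y => pd g 2 y) (dζ K) := fun x hx => by
  simp [pd, (hg.hasFDerivAt hx).fderiv, radialCovector_apply]

lemma norm_fderiv_le (hg : IsProfile g K) {x : E3} (hx : 0 < rr x) :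
    ‖fderiv ℝ g x‖ ≤ |dρ K (rr x, x 2)| + |dζ K (rr x, x 2)| := by
  rw [(hg.hasFDerivAt hx).fderiv]
  refine (norm_add_le _ _).trans (add_le_add ?_ ?_) <;> rw [norm_smul, norm_eq_abs]
  · exact mul_le_of_le_one_right (abs_nonneg _) (norm_radialCovector_le hx)
  · refine mul_le_of_le_one_right (abs_nonneg _)
      (ContinuousLinearMap.opNorm_le_bound _ zero_le_one fun v => ?_)
    rw [one_mul]
    exact PiLp.norm_apply_le v 2

lemma abs_dζ_le (hg : IsProfile g K) {x : E3} (hx : 0 < rr x) :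
    |dζ K (rr x, x 2)| ≤ ‖fderiv ℝ g x‖ := by
  have h := (fderiv ℝ g x).le_opNorm (EuclideanSpace.single 2 1)
  have e : fderiv ℝ g x (EuclideanSpace.single 2 1) = dζ K (rr x, x 2) := hg.vertical x hx
  rw [e] at h
  simpa using h

end IsProfile

lemma eLpNorm_two_sq {F : Type*} [NormedAddCommGroup F] (g : E3 → F) (μ : Measure E3) :
    eLpNorm g 2 μ ^ 2 = ∫⁻ x, ‖g x‖ₑ ^ 2 ∂μ := by
  have := eLpNorm_nnreal_pow_eq_lintegral (f := g) (μ := μ) (p := 2) two_ne_zero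
  simpa using this

lemma eLpNorm_le_uloc3On {F : Type*} [NormedAddCommGroup F] (g : E3 → F) (y : ℝ) :
    eLpNorm g 2 (volume.restrict (slab y)) ≤ uloc3On g 2 {x : E3 | 0 < rr x} :=
  le_iSup (fun z : ℝ => eLpNorm g 2
    (volume.restrict ({x : E3 | 0 < rr x} ∩ {x : E3 | x 2 ∈ Icc (z - 1) (z + 1)}))) y

lemma enorm_sq_eq_ofReal {F : Type*} [NormedAddCommGroup F] (a : F) :
    ‖a‖ₑ ^ 2 = ENNReal.ofReal (‖a‖ ^ 2) := by
  rw [ENNReal.ofReal_pow (norm_nonneg a), ofReal_norm]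

lemma mul_iSup_localEnergy_le {F : Type*} [NormedAddCommGroup F] {g : E3 → F} {K : PlaneSchwartz}
    (hg : ∀ x, 0 < rr x → |K (rr x, x 2)| ≤ ‖g x‖) :
    ENNReal.ofReal (2 * π) * ⨆ y, localEnergy y K ≤ uloc3On g 2 {x : E3 | 0 < rr x} ^ 2 := by
  rw [ENNReal.mul_iSup]
  refine iSup_le fun y => ?_
  rw [← lintegral_slab_sq]
  refine le_trans ?_ (pow_le_pow_left' (eLpNorm_le_uloc3On g y) 2)
  rw [eLpNorm_two_sq]
  refine setLIntegral_mono' (measurableSet_slab y) fun x hx => ?_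
  rw [enorm_sq_eq_ofReal, ← sq_abs]
  exact ENNReal.ofReal_le_ofReal (pow_le_pow_left₀ (abs_nonneg _) (hg x hx.1) 2)

lemma uloc3On_fderiv_le {g : E3 → ℝ} {K : PlaneSchwartz} (hg : IsProfile g K) {M : ℝ≥0∞}
    (hM : ∀ y, 2 * (ENNReal.ofReal (2 * π) * (localEnergy y (dρ K) + localEnergy y (dζ K)))
      ≤ M ^ 2) :
    uloc3On (fun x => fderiv ℝ g x) 2 {x : E3 | 0 < rr x} ≤ M := by
  refine iSup_le fun y => ?_
  refine (ENNReal.pow_le_pow_left_iff two_ne_zero).1 (le_trans ?_ (hM y))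
  rw [eLpNorm_two_sq, mul_add, ← lintegral_slab_sq, ← lintegral_slab_sq, mul_add,
    ← lintegral_const_mul' _ _ (by simp), ← lintegral_const_mul' _ _ (by simp),
    ← lintegral_add_left']
  · refine setLIntegral_mono' (measurableSet_slab y) fun x hx => ?_
    have hdouble (a : ℝ) : 2 * ENNReal.ofReal a = ENNReal.ofReal (2 * a) := by
      rw [ENNReal.ofReal_mul (by norm_num), ENNReal.ofReal_ofNat]
    rw [← mul_add, ← ENNReal.ofReal_add (sq_nonneg _) (sq_nonneg _), enorm_sq_eq_ofReal, hdouble]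
    refine ENNReal.ofReal_le_ofReal ?_
    refine (pow_le_pow_left₀ (norm_nonneg _) (hg.norm_fderiv_le hx.1) 2).trans ?_
    refine (add_sq_le).trans_eq ?_
    rw [sq_abs, sq_abs]
  · have h1 := (dρ K).continuous
    have h2 := continuous_rr
    have h3 : Measurable fun x : E3 => dρ K (rr x, x 2) ^ 2 := by
      exact Continuous.measurable (by fun_prop)
    exact (h3.ennreal_ofReal.const_mul 2).aemeasurable

lemma localEnergy_second_order_le_sq {u : SchwartzMap E3 E3} (hu : IsAxisymmetric u)
    {K B G : PlaneSchwartz} (hB : ∀ p, dρ K p = p.1 * B p)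
    (hK : ∀ p, dρ (dρ K) p + 3 * B p + dζ (dζ K) p = dζ G p)
    (hG : ∀ p, toPlane (vorticityTwo u) p = p.1 * G p) {g : E3 → ℝ} (hg : IsProfile g G) (y : ℝ) :
    2 * (ENNReal.ofReal (2 * π) * (localEnergy y (dρ (dρ K)) + localEnergy y (dζ (dζ K))
      + 2 * localEnergy y (dρ (dζ K)))) ≤
      (60 * (uloc3On g 2 {x : E3 | 0 < rr x}
        + uloc3On (fun x => fderiv ℝ g x) 2 {x : E3 | 0 < rr x})) ^ 2 := by
  have hle := localEnergy_second_order_le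
    (weightedEnergy_second_order_le hu.isHorizontal_vorticityTwo hB hK hG) y
  have hP := mul_iSup_localEnergy_le (g := g) (K := G) fun x hx => by rw [← hg x hx, norm_eq_abs]
  have hQ := mul_iSup_localEnergy_le (g := fun x => fderiv ℝ g x) fun x hx => hg.abs_dζ_le hx
  set P := uloc3On g 2 {x : E3 | 0 < rr x}
  set Q := uloc3On (fun x => fderiv ℝ g x) 2 {x : E3 | 0 < rr x}
  have hc : 2 * (480 * ENNReal.ofReal π) ≤ 60 ^ 2 := by
    calc 2 * (480 * ENNReal.ofReal π) ≤ 2 * (480 * ENNReal.ofReal (15 / 4)) := by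
          gcongr
          linarith [pi_lt_d2]
      _ = ENNReal.ofReal (2 * (480 * (15 / 4))) := by
          rw [ENNReal.ofReal_mul (by norm_num), ENNReal.ofReal_mul (by norm_num),
            ENNReal.ofReal_ofNat, ENNReal.ofReal_ofNat]
      _ = 60 ^ 2 := by
          rw [show (2 : ℝ) * (480 * (15 / 4)) = 60 ^ 2 by norm_num,
            ENNReal.ofReal_pow (by norm_num), ENNReal.ofReal_ofNat]
  calc _ ≤ 2 * (ENNReal.ofReal (2 * π) * (480 * ENNReal.ofReal π
        * ((⨆ y, localEnergy y G) + ⨆ y, localEnergy y (dζ G)))) := by gcongr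
    _ = 2 * (480 * ENNReal.ofReal π) * (ENNReal.ofReal (2 * π) * (⨆ y, localEnergy y G)
        + ENNReal.ofReal (2 * π) * ⨆ y, localEnergy y (dζ G)) := by ring
    _ ≤ 60 ^ 2 * (P ^ 2 + Q ^ 2) := by gcongr
    _ ≤ 60 ^ 2 * (P + Q) ^ 2 := by
        gcongr
        rw [add_sq, add_right_comm]
        exact le_self_add
    _ = (60 * (P + Q)) ^ 2 := (mul_pow _ _ _).symm

lemma uloc3On_second_order_le {u : SchwartzMap E3 E3} (hu : IsAxisymmetric u)
    (hdiv : ∀ x : E3, (∑ i : Fin 3, pd (fun y => u y i) i x) = 0) :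
    uloc3On (fun x => fderiv ℝ (dr (urr u)) x) 2 {x : E3 | 0 < rr x} +
      uloc3On (fun x => fderiv ℝ (fun y => pd (urr u) 2 y) x) 2 {x : E3 | 0 < rr x} ≤
    120 * (uloc3On (GammaOf u) 2 {x : E3 | 0 < rr x} +
      uloc3On (fun x => fderiv ℝ (GammaOf u) x) 2 {x : E3 | 0 < rr x}) := by
  obtain ⟨K, B, G, hB, hK, hG, hprof⟩ := exists_profiles hu hdiv
  have hKu : IsProfile (urr u) K := fun x hx => (hprof x hx).1
  have hGu : IsProfile (GammaOf u) G := fun x hx => (hprof x hx).2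
  have hle := localEnergy_second_order_le_sq hu hB hK hG hGu
  have hcomm : dζ (dρ K) = dρ (dζ K) := (dρ_dζ K).symm
  have hr := uloc3On_fderiv_le hKu.radial fun y => by
    refine le_trans ?_ (hle y)
    rw [hcomm]
    gcongr
    · exact le_self_add
    · exact le_mul_of_one_le_left' one_le_two
  have hz := uloc3On_fderiv_le hKu.vertical fun y => by
    refine le_trans ?_ (hle y)
    gcongr 2 * (_ * ?_)
    rw [add_comm (localEnergy y (dρ (dρ K))), add_assoc, add_comm]
    gcongr
    exact (le_mul_of_one_le_left' one_le_two).trans le_add_self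
  refine (add_le_add hr hz).trans_eq ?_
  rw [← add_mul]
  norm_num

end SpaceSchwartz

/-- Poisson-type `x₃`-uloc estimate on `u_r/r` in terms of `Γ`. -/
theorem stmt15 :
    ∃ C : ℝ, 0 < C ∧
      ∀ u : SchwartzMap E3 E3,
        (∀ θ x, u (rotZ θ x) = rotZ θ (u x)) →
        (∀ x : E3, (∑ i : Fin 3, pd (fun y => u y i) i x) = 0) →
        uloc3On (fun x => fderiv ℝ (dr (urr (⇑u))) x) 2 {x : E3 | 0 < rr x} +
          uloc3On (fun x => fderiv ℝ (fun y => pd (urr (⇑u)) 2 y) x) 2 {x : E3 | 0 < rr x} ≤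
        ENNReal.ofReal C *
          (uloc3On (GammaOf (⇑u)) 2 {x : E3 | 0 < rr x} +
            uloc3On (fun x => fderiv ℝ (GammaOf (⇑u)) x) 2 {x : E3 | 0 < rr x}) := by
  refine ⟨120, by norm_num, fun u hu hdiv => ?_⟩
  rw [ENNReal.ofReal_ofNat]
  exact SpaceSchwartz.uloc3On_second_order_le hu hdiv
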